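/- Fix K ∈ ℕ_0 and let λ^{(n)} be the n-th diagram of the Plancherel growth process. Then the total variation distance between (i) the Plancherel measure Pl_n on 𝕐_n, i.e., the distribution of λ^{(n)}, and (ii) the conditional distribution of λ^{(n)} given that none of the events E_0^{(n)}, …, E_K^{(n)} occurred, is of order o(1/√n) as n → ∞. -/

import Mathlib

open MeasureTheory Filter

/-- The number of standard Young tableaux of shape `μ`: bijective fillings of the cells of `μ`
by `0, 1, …, μ.card - 1` that are strictly increasing along rows and columns. -/
noncomputable def sytCount (μ : YoungDiagram) : ℕ :=
  Nat.card {T : μ.cells → Fin μ.card //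
    Function.Bijective T ∧
      ∀ a b : μ.cells, (a : ℕ × ℕ).1 ≤ (b : ℕ × ℕ).1 → (a : ℕ × ℕ).2 ≤ (b : ℕ × ℕ).2 →
        a ≠ b → T a < T b}

/-- `lam 0 ↗ lam 1 ↗ ⋯` is a Plancherel growth process: the probability of any prescribed
initial path `∅ = μ⁽⁰⁾ ↗ μ⁽¹⁾ ↗ ⋯ ↗ μ⁽ⁿ⁾` in the Young graph equals `d_{μ⁽ⁿ⁾} / n!`,
which characterizes the distribution of the sequence of RSK shapes of an i.i.d. uniform
sequence. -/
def IsPlancherelGrowthProcess {Ω : Type*} [MeasurableSpace Ω] (P : Measure Ω)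
    (lam : ℕ → Ω → YoungDiagram) : Prop :=
  IsProbabilityMeasure P ∧
  (∀ (n : ℕ) (y : YoungDiagram), MeasurableSet {ω | lam n ω = y}) ∧
  ∀ (n : ℕ) (path : ℕ → YoungDiagram), path 0 = ⊥ →
    (∀ i, i < n → path i ≤ path (i + 1) ∧ (path (i + 1)).card = (path i).card + 1) →
    P {ω | ∀ i ≤ n, lam i ω = path i} =
      (sytCount (path n) : ENNReal) / (Nat.factorial n : ENNReal)

/-- The event `E_r⁽ⁿ⁺¹⁾` that the box added in step `n+1` of the growth process
(i.e. the unique box of `λ⁽ⁿ⁺¹⁾ ∖ λ⁽ⁿ⁾`) lies in the row with index `r`. -/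
def growthEvent {Ω : Type*} (lam : ℕ → Ω → YoungDiagram) (n r : ℕ) : Set Ω :=
  {ω | (lam (n + 1) ω).rowLen r = (lam n ω).rowLen r + 1}

/-- The Plancherel measure `Pl_n` on Young diagrams with `n` boxes: the probability of a
diagram `μ` with `μ.card = n` is `d_μ² / n!` (and `0` for diagrams with `μ.card ≠ n`). -/
noncomputable def plancherelProb (n : ℕ) (μ : YoungDiagram) : ℝ :=
  if μ.card = n then (sytCount μ : ℝ) ^ 2 / (Nat.factorial n : ℝ) else 0

namespace PG
section
open scoped Classical

theorem rowLen_le_card (μ : YoungDiagram) (i : ℕ) : μ.rowLen i ≤ μ.card := by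
  rw [YoungDiagram.rowLen_eq_card]
  exact Finset.card_le_card (by intro x hx; exact (YoungDiagram.mem_row_iff.1 hx).1)

theorem colLen_le_card (μ : YoungDiagram) (i : ℕ) : μ.colLen i ≤ μ.card := by
  rw [YoungDiagram.colLen_eq_card]
  exact Finset.card_le_card (by intro x hx; exact (YoungDiagram.mem_col_iff.1 hx).1)

theorem rowLen_eq_zero {μ : YoungDiagram} {i : ℕ} (h : μ.card ≤ i) : μ.rowLen i = 0 := by
  by_contra hne
  have h1 : (i, 0) ∈ μ := YoungDiagram.mem_iff_lt_rowLen.2 (Nat.pos_of_ne_zero hne)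
  have h2 := YoungDiagram.mem_iff_lt_colLen.1 h1
  have := colLen_le_card μ 0
  omega

theorem cells_inj {μ ν : YoungDiagram} (h : μ.cells = ν.cells) : μ = ν := YoungDiagram.ext h

theorem finite_card (n : ℕ) : {μ : YoungDiagram | μ.card = n}.Finite := by
  have h : (((Finset.range n ×ˢ Finset.range n).powerset : Finset (Finset (ℕ × ℕ))) :
      Set (Finset (ℕ × ℕ))).Finite := Finset.finite_toSet _
  refine Set.Finite.of_finite_image (f := YoungDiagram.cells) (h.subset ?_)
    (fun a _ b _ hab => cells_inj hab)
  rintro _ ⟨μ, hμ, rfl⟩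
  simp only [Finset.coe_powerset, Set.mem_preimage, Set.mem_powerset_iff, Finset.coe_subset]
  rintro ⟨i, j⟩ hc
  have hc : (i, j) ∈ μ := hc
  have h1 := YoungDiagram.mem_iff_lt_colLen.1 hc
  have h2 := YoungDiagram.mem_iff_lt_rowLen.1 hc
  have h3 := colLen_le_card μ j
  have h4 := rowLen_le_card μ i
  have h5 : μ.card = n := hμ
  simp only [Finset.mem_product, Finset.mem_range]
  omega

/-- diagrams with `n` boxes -/
noncomputable def Y (n : ℕ) : Finset YoungDiagram := (finite_card n).toFinset

theorem mem_Y {n : ℕ} {μ : YoungDiagram} : μ ∈ Y n ↔ μ.card = n := by simp [Y]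

noncomputable def up (ν : YoungDiagram) : Finset YoungDiagram :=
  (Y (ν.card + 1)).filter (fun μ => ν ≤ μ)

noncomputable def dn (μ : YoungDiagram) : Finset YoungDiagram :=
  (Y (μ.card - 1)).filter (fun ν => ν ≤ μ ∧ μ.card = ν.card + 1)

theorem mem_up {ν μ : YoungDiagram} : μ ∈ up ν ↔ ν ≤ μ ∧ μ.card = ν.card + 1 := by
  simp [up, mem_Y, and_comm]

theorem mem_dn {ν μ : YoungDiagram} : ν ∈ dn μ ↔ ν ≤ μ ∧ μ.card = ν.card + 1 := by
  simp only [dn, mem_Y, Finset.mem_filter]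
  constructor
  · exact fun h => h.2
  · exact fun h => ⟨by omega, h⟩

theorem mem_dn_iff {ν μ : YoungDiagram} : ν ∈ dn μ ↔ μ ∈ up ν := by rw [mem_dn, mem_up]

theorem sum_swap (n : ℕ) (f : YoungDiagram → YoungDiagram → ℝ) :
    ∑ ν ∈ Y n, ∑ μ ∈ up ν, f ν μ = ∑ μ ∈ Y (n + 1), ∑ ν ∈ dn μ, f ν μ := by
  apply Finset.sum_comm'
  intro x y
  rw [mem_dn, mem_up, mem_Y, mem_Y]
  constructor
  · rintro ⟨h1, h2, h3⟩; exact ⟨⟨h2, h3⟩, by omega⟩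
  · rintro ⟨⟨h1, h2⟩, h3⟩; exact ⟨by omega, h1, h2⟩

/-- weight of a diagram -/
noncomputable def wt (w : ℕ × ℕ → ℝ) (μ : YoungDiagram) : ℝ := ∑ c ∈ μ.cells, w c

theorem wt_modular (w : ℕ × ℕ → ℝ) (a b : YoungDiagram) :
    wt w (a ⊔ b) + wt w (a ⊓ b) = wt w a + wt w b := by
  simp only [wt, YoungDiagram.cells_sup, YoungDiagram.cells_inf]
  exact Finset.sum_union_inter

theorem card_modular (a b : YoungDiagram) :
    (a ⊔ b).card + (a ⊓ b).card = a.card + b.card := by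
  simp only [YoungDiagram.card, YoungDiagram.cells_sup, YoungDiagram.cells_inf]
  exact Finset.card_union_add_card_inter _ _

theorem eq_of_le_card {a b : YoungDiagram} (h : a ≤ b) (hc : b.card ≤ a.card) : a = b :=
  cells_inj (Finset.eq_of_subset_of_card_le (YoungDiagram.cells_subset_iff.2 h) hc)

/-- the diagonal part of the commutator -/
noncomputable def pw (w : ℕ × ℕ → ℝ) (l : YoungDiagram) : ℝ :=
  ∑ μ ∈ up l, (wt w μ - wt w l) - ∑ κ ∈ dn l, (wt w l - wt w κ)

theorem comm (w : ℕ × ℕ → ℝ) (g : YoungDiagram → ℝ) (l : YoungDiagram) :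
    ∑ μ ∈ up l, ∑ ν ∈ dn μ, (wt w μ - wt w l) * g ν =
      pw w l * g l + ∑ κ ∈ dn l, ∑ ν ∈ up κ, (wt w ν - wt w κ) * g ν := by
  have h1 : ∀ μ ∈ up l, ∑ ν ∈ dn μ, (wt w μ - wt w l) * g ν =
      (wt w μ - wt w l) * g l + ∑ ν ∈ (dn μ).erase l, (wt w μ - wt w l) * g ν := by
    intro μ hμ
    rw [Finset.add_sum_erase (dn μ) (fun ν => (wt w μ - wt w l) * g ν) (mem_dn_iff.2 hμ)]
  have h2 : ∀ κ ∈ dn l, ∑ ν ∈ up κ, (wt w ν - wt w κ) * g ν =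
      (wt w l - wt w κ) * g l + ∑ ν ∈ (up κ).erase l, (wt w ν - wt w κ) * g ν := by
    intro κ hκ
    rw [Finset.add_sum_erase (up κ) (fun ν => (wt w ν - wt w κ) * g ν) (mem_dn_iff.1 hκ)]
  rw [Finset.sum_congr rfl h1, Finset.sum_congr rfl h2, Finset.sum_add_distrib,
    Finset.sum_add_distrib]
  have h3 : ∑ μ ∈ up l, ∑ ν ∈ (dn μ).erase l, (wt w μ - wt w l) * g ν =
      ∑ κ ∈ dn l, ∑ ν ∈ (up κ).erase l, (wt w ν - wt w κ) * g ν := by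
    rw [Finset.sum_sigma', Finset.sum_sigma']
    refine Finset.sum_nbij' (fun p => ⟨l ⊓ p.2, p.2⟩) (fun p => ⟨l ⊔ p.2, p.2⟩) ?_ ?_ ?_ ?_ ?_
    · rintro ⟨μ, ν⟩ h
      simp only [Finset.mem_sigma, Finset.mem_erase, mem_up, mem_dn] at h ⊢
      obtain ⟨⟨a1, a2⟩, a3, a4, a5⟩ := h
      have hlt : l < l ⊔ ν := by
        refine lt_of_le_of_ne le_sup_left fun he => a3 ?_
        exact eq_of_le_card (he ▸ le_sup_right) (by omega)
      have hsup : l ⊔ ν = μ := by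
        refine eq_of_le_card (sup_le a1 a4) ?_
        have := Finset.card_lt_card (YoungDiagram.cells_ssubset_iff.2 hlt)
        simp only [YoungDiagram.card] at *
        omega
      have := card_modular l ν
      rw [hsup] at this
      exact ⟨⟨inf_le_left, by omega⟩, a3, inf_le_right, by omega⟩
    · rintro ⟨κ, ν⟩ h
      simp only [Finset.mem_sigma, Finset.mem_erase, mem_up, mem_dn] at h ⊢
      obtain ⟨⟨a1, a2⟩, a3, a4, a5⟩ := h
      have hlt : l ⊓ ν < l := by
        refine lt_of_le_of_ne inf_le_left fun he => a3 ?_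
        exact (eq_of_le_card (he ▸ inf_le_right) (by omega)).symm
      have hinf : κ = l ⊓ ν := by
        refine eq_of_le_card (le_inf a1 a4) ?_
        have := Finset.card_lt_card (YoungDiagram.cells_ssubset_iff.2 hlt)
        simp only [YoungDiagram.card] at *
        omega
      have := card_modular l ν
      rw [← hinf] at this
      exact ⟨⟨le_sup_left, by omega⟩, a3, le_sup_right, by omega⟩
    · rintro ⟨μ, ν⟩ h
      simp only [Finset.mem_sigma, Finset.mem_erase, mem_up, mem_dn] at h ⊢
      obtain ⟨⟨a1, a2⟩, a3, a4, a5⟩ := h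
      have hlt : l < l ⊔ ν := by
        refine lt_of_le_of_ne le_sup_left fun he => a3 ?_
        exact eq_of_le_card (he ▸ le_sup_right) (by omega)
      have hsup : l ⊔ ν = μ := by
        refine eq_of_le_card (sup_le a1 a4) ?_
        have := Finset.card_lt_card (YoungDiagram.cells_ssubset_iff.2 hlt)
        simp only [YoungDiagram.card] at *
        omega
      rw [hsup]
    · rintro ⟨κ, ν⟩ h
      simp only [Finset.mem_sigma, Finset.mem_erase, mem_up, mem_dn] at h ⊢
      obtain ⟨⟨a1, a2⟩, a3, a4, a5⟩ := h
      have hlt : l ⊓ ν < l := by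
        refine lt_of_le_of_ne inf_le_left fun he => a3 ?_
        exact (eq_of_le_card (he ▸ inf_le_right) (by omega)).symm
      have hinf : κ = l ⊓ ν := by
        refine eq_of_le_card (le_inf a1 a4) ?_
        have := Finset.card_lt_card (YoungDiagram.cells_ssubset_iff.2 hlt)
        simp only [YoungDiagram.card] at *
        omega
      rw [← hinf]
    · rintro ⟨μ, ν⟩ h
      simp only [Finset.mem_sigma, Finset.mem_erase, mem_up, mem_dn] at h ⊢
      obtain ⟨⟨a1, a2⟩, a3, a4, a5⟩ := h
      have hlt : l < l ⊔ ν := by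
        refine lt_of_le_of_ne le_sup_left fun he => a3 ?_
        exact eq_of_le_card (he ▸ le_sup_right) (by omega)
      have hsup : l ⊔ ν = μ := by
        refine eq_of_le_card (sup_le a1 a4) ?_
        have := Finset.card_lt_card (YoungDiagram.cells_ssubset_iff.2 hlt)
        simp only [YoungDiagram.card] at *
        omega
      have := wt_modular w l ν
      rw [hsup] at this
      congr 1
      linarith
  rw [h3, pw, sub_mul, Finset.sum_mul, Finset.sum_mul]
  ring

/-- structure of a cover -/
theorem up_cell {ν μ : YoungDiagram} (h : μ ∈ up ν) :
    ∃ i, (i, ν.rowLen i) ∉ ν.cells ∧ μ.cells = insert (i, ν.rowLen i) ν.cells ∧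
      (∀ j < i, ν.rowLen i < ν.rowLen j) := by
  obtain ⟨h1, h2⟩ := mem_up.1 h
  have hs := YoungDiagram.cells_subset_iff.2 h1
  have hc : (μ.cells \ ν.cells).card = 1 := by
    rw [Finset.card_sdiff_of_subset hs]
    simp only [YoungDiagram.card] at h2
    omega
  obtain ⟨⟨i, j⟩, hij⟩ := Finset.card_eq_one.1 hc
  have key : ∀ c, c ∈ μ → c ∉ ν → c = (i, j) := by
    intro c hc1 hc2
    have : c ∈ μ.cells \ ν.cells := by simp [hc1, hc2]
    rw [hij] at this
    simpa using this
  have hmem : (i, j) ∈ μ.cells \ ν.cells := by rw [hij]; simp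
  have hm : (i, j) ∈ μ := (Finset.mem_sdiff.1 hmem).1
  have hn : (i, j) ∉ ν := (Finset.mem_sdiff.1 hmem).2
  have hj : ν.rowLen i ≤ j := by
    by_contra hlt
    exact hn (YoungDiagram.mem_iff_lt_rowLen.2 (by omega))
  have hni : (i, ν.rowLen i) ∉ ν := fun hh => by
    have := YoungDiagram.mem_iff_lt_rowLen.1 hh; omega
  have hj' : ν.rowLen i = j := by
    have := key _ (μ.up_left_mem le_rfl hj hm) hni
    simpa using this
  refine ⟨i, hni, ?_, ?_⟩
  · rw [hj', ← Finset.sdiff_union_of_subset hs, hij]; rfl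
  · intro k hk
    rw [← YoungDiagram.mem_iff_lt_rowLen]
    by_contra hcon
    have := key _ (μ.up_left_mem hk.le (le_of_eq hj') hm) hcon
    simp at this
    omega

theorem wt_up {ν μ : YoungDiagram} {c : ℕ × ℕ} (hc : c ∉ ν.cells) (h : μ.cells = insert c ν.cells)
    (w : ℕ × ℕ → ℝ) : wt w μ - wt w ν = w c := by
  simp [wt, h, Finset.sum_insert hc]

theorem up_of_cells {ν μ : YoungDiagram} {c : ℕ × ℕ} (hc : c ∉ ν.cells)
    (h : μ.cells = insert c ν.cells) : μ ∈ up ν := by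
  rw [mem_up, ← YoungDiagram.cells_subset_iff, h]
  refine ⟨Finset.subset_insert _ _, ?_⟩
  simp only [YoungDiagram.card, h, Finset.card_insert_of_notMem hc]

theorem row_notMem (ν : YoungDiagram) (i : ℕ) : (i, ν.rowLen i) ∉ ν := fun hh => by
    have := YoungDiagram.mem_iff_lt_rowLen.1 hh; omega

/-- add a box in row i -/
def addRow (ν : YoungDiagram) (i : ℕ) (h : ∀ j < i, ν.rowLen i < ν.rowLen j) : YoungDiagram where
  cells := insert (i, ν.rowLen i) ν.cells
  isLowerSet := by
    rintro ⟨a, b⟩ ⟨a', b'⟩ hle hmem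
    simp only [Prod.mk_le_mk] at hle
    simp only [Finset.coe_insert, Set.mem_insert_iff, Finset.mem_coe, YoungDiagram.mem_cells,
      Prod.mk.injEq, YoungDiagram.mem_iff_lt_rowLen] at hmem ⊢
    rcases hmem with ⟨rfl, rfl⟩ | hmem
    · rcases Nat.lt_or_ge a' a with h1 | h1
      · right
        exact lt_of_le_of_lt hle.2 (h _ h1)
      · have : a' = a := le_antisymm hle.1 h1
        subst this
        omega
    · right
      have := ν.rowLen_anti a' a hle.1
      omega

/-- remove a box in row i -/
def remRow (μ : YoungDiagram) (i : ℕ) (h : μ.rowLen (i + 1) < μ.rowLen i) : YoungDiagram where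
  cells := μ.cells.erase (i, μ.rowLen i - 1)
  isLowerSet := by
    rintro ⟨a, b⟩ ⟨a', b'⟩ hle hmem
    simp only [Prod.mk_le_mk] at hle
    simp only [Finset.coe_erase, Set.mem_sdiff, Finset.mem_coe, YoungDiagram.mem_cells,
      Set.mem_singleton_iff, Prod.mk.injEq, YoungDiagram.mem_iff_lt_rowLen] at hmem ⊢
    have h1 := μ.rowLen_anti a' a hle.1
    refine ⟨by omega, ?_⟩
    rintro ⟨rfl, rfl⟩
    rcases Nat.lt_or_ge a' a with h2 | h2
    · have := μ.rowLen_anti (a' + 1) a h2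
      omega
    · have : a = a' := le_antisymm h2 hle.1
      subst this
      omega

theorem sum_up (w : ℕ × ℕ → ℝ) (l : YoungDiagram) :
    ∑ μ ∈ up l, (wt w μ - wt w l) =
      ∑ i ∈ (Finset.range (l.card + 1)).filter (fun i => ∀ j < i, l.rowLen i < l.rowLen j),
        w (i, l.rowLen i) := by
  symm
  refine Finset.sum_bij (fun i hi => addRow l i (Finset.mem_filter.1 hi).2) ?_ ?_ ?_ ?_
  · intro i hi
    exact up_of_cells (row_notMem l i) rfl
  · intro i hi j hj hij
    have h1 : (i, l.rowLen i) ∈ (addRow l i (Finset.mem_filter.1 hi).2).cells :=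
      Finset.mem_insert_self _ _
    have hij : addRow l i (Finset.mem_filter.1 hi).2 = addRow l j (Finset.mem_filter.1 hj).2 := hij
    rw [hij] at h1
    rcases Finset.mem_insert.1 h1 with h2 | h2
    · exact (Prod.ext_iff.1 h2).1
    · exact absurd h2 (row_notMem l i)
  · intro μ hμ
    obtain ⟨i, h1, h2, h3⟩ := up_cell hμ
    refine ⟨i, ?_, cells_inj h2.symm⟩
    refine Finset.mem_filter.2 ⟨?_, h3⟩
    rw [Finset.mem_range]
    by_contra hcon
    have := h3 l.card (by omega)
    rw [rowLen_eq_zero le_rfl] at this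
    omega
  · intro i hi
    exact (wt_up (row_notMem l i) rfl w).symm

theorem sum_dn (w : ℕ × ℕ → ℝ) (l : YoungDiagram) :
    ∑ κ ∈ dn l, (wt w l - wt w κ) =
      ∑ i ∈ (Finset.range l.card).filter (fun i => l.rowLen (i + 1) < l.rowLen i),
        w (i, l.rowLen i - 1) := by
  symm
  have hme : ∀ i, l.rowLen (i + 1) < l.rowLen i → (i, l.rowLen i - 1) ∈ l.cells := by
    intro i hi
    exact YoungDiagram.mem_iff_lt_rowLen.2 (by omega)
  have hins : ∀ i (hi : l.rowLen (i + 1) < l.rowLen i),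
      l.cells = insert (i, l.rowLen i - 1) (remRow l i hi).cells := by
    intro i hi
    exact (Finset.insert_erase (hme i hi)).symm
  have hnot : ∀ i (hi : l.rowLen (i + 1) < l.rowLen i),
      (i, l.rowLen i - 1) ∉ (remRow l i hi).cells := by
    intro i hi
    exact Finset.notMem_erase _ _
  refine Finset.sum_bij (fun i hi => remRow l i (Finset.mem_filter.1 hi).2) ?_ ?_ ?_ ?_
  · intro i hi
    exact mem_dn_iff.2 (up_of_cells (hnot i _) (hins i _))
  · intro i hi j hj hij
    have hij : remRow l i (Finset.mem_filter.1 hi).2 = remRow l j (Finset.mem_filter.1 hj).2 := hij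
    by_contra hne
    apply hnot i (Finset.mem_filter.1 hi).2
    rw [hij]
    refine Finset.mem_erase.2 ⟨?_, hme i (Finset.mem_filter.1 hi).2⟩
    intro h
    exact hne (Prod.ext_iff.1 h).1
  · intro κ hκ
    obtain ⟨i, h1, h2, h3⟩ := up_cell (mem_dn_iff.1 hκ)
    have m1 : (i, κ.rowLen i) ∈ l := by
      rw [← YoungDiagram.mem_cells, h2]; exact Finset.mem_insert_self _ _
    have m2 : (i, κ.rowLen i + 1) ∉ l := by
      rw [← YoungDiagram.mem_cells, h2, Finset.mem_insert, YoungDiagram.mem_cells,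
        YoungDiagram.mem_iff_lt_rowLen]
      simp
    have m3 : (i + 1, κ.rowLen i) ∉ l := by
      rw [← YoungDiagram.mem_cells, h2, Finset.mem_insert, YoungDiagram.mem_cells,
        YoungDiagram.mem_iff_lt_rowLen]
      have := κ.rowLen_anti i (i + 1) (by omega)
      simp; omega
    rw [YoungDiagram.mem_iff_lt_rowLen] at m1 m2 m3
    have hi : l.rowLen (i + 1) < l.rowLen i := by omega
    refine ⟨i, Finset.mem_filter.2 ⟨?_, hi⟩, ?_⟩
    · rw [Finset.mem_range]
      by_contra hcon
      rw [rowLen_eq_zero (not_lt.1 hcon)] at hi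
      omega
    · apply cells_inj
      have : l.rowLen i - 1 = κ.rowLen i := by omega
      simp only [remRow, this]
      rw [h2, Finset.erase_insert h1]
  · intro i hi
    exact (wt_up (hnot i (Finset.mem_filter.1 hi).2) (hins i _) w).symm

theorem pw_eq (w : ℕ × ℕ → ℝ) (l : YoungDiagram) :
    pw w l = w (0, l.rowLen 0) + ∑ i ∈ Finset.range l.card,
      if l.rowLen (i + 1) < l.rowLen i then
        w (i + 1, l.rowLen (i + 1)) - w (i, l.rowLen i - 1) else 0 := by
  rw [pw, sum_up, sum_dn, Finset.sum_filter, Finset.sum_filter, Finset.sum_range_succ']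
  simp only [Nat.not_lt_zero, IsEmpty.forall_iff, implies_true, if_true]
  rw [add_sub_right_comm, ← Finset.sum_sub_distrib, add_comm]
  congr 1
  refine Finset.sum_congr rfl fun i _ => ?_
  have : (∀ j < i + 1, l.rowLen (i + 1) < l.rowLen j) ↔ l.rowLen (i + 1) < l.rowLen i := by
    constructor
    · intro h; exact h i (by omega)
    · intro h j hj
      have := l.rowLen_anti j i (by omega)
      omega
  simp only [this]
  split_ifs <;> simp

theorem sum_cells (f : ℕ × ℕ → ℝ) (l : YoungDiagram) :
    wt f l = ∑ i ∈ Finset.range l.card, ∑ j ∈ Finset.range (l.rowLen i), f (i, j) := by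
  rw [wt, Finset.sum_sigma']
  refine Finset.sum_nbij' (fun c => ⟨c.1, c.2⟩) (fun p => (p.1, p.2)) ?_ ?_ ?_ ?_ ?_
  · rintro ⟨i, j⟩ h
    have h : (i, j) ∈ l := h
    have h2 := YoungDiagram.mem_iff_lt_colLen.1 h
    have := colLen_le_card l j
    simp only [Finset.mem_sigma, Finset.mem_range]
    exact ⟨by omega, YoungDiagram.mem_iff_lt_rowLen.1 h⟩
  · rintro ⟨i, j⟩ h
    simp only [Finset.mem_sigma, Finset.mem_range] at h
    exact YoungDiagram.mem_iff_lt_rowLen.2 h.2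
  · rintro ⟨i, j⟩ _; rfl
  · rintro ⟨i, j⟩ _; rfl
  · rintro ⟨i, j⟩ _; rfl

/-- content weights -/
noncomputable def ct (φ : ℝ → ℝ) (c : ℕ × ℕ) : ℝ := φ ((c.2 : ℝ) - c.1)

theorem pw_ct (φ : ℝ → ℝ) (l : YoungDiagram) :
    pw (ct φ) l = φ 0 + wt (ct fun x => φ (x + 1) + φ (x - 1) - 2 * φ x) l := by
  rw [pw_eq, sum_cells]
  have h1 : ∀ i ∈ Finset.range l.card, (if l.rowLen (i + 1) < l.rowLen i then
        ct φ (i + 1, l.rowLen (i + 1)) - ct φ (i, l.rowLen i - 1) else 0) =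
        φ ((l.rowLen (i + 1) : ℝ) - (i + 1 : ℕ)) - φ ((l.rowLen i : ℝ) - i - 1) := by
    intro i _
    split_ifs with h
    · simp only [ct]
      congr 2
      rw [Nat.cast_sub (by omega)]
      push_cast; ring
    · have := l.rowLen_anti i (i + 1) (by omega)
      have : l.rowLen (i + 1) = l.rowLen i := by omega
      rw [this]; push_cast
      ring_nf
  have h2 : ∀ i ∈ Finset.range l.card, (∑ j ∈ Finset.range (l.rowLen i),
      ct (fun x => φ (x + 1) + φ (x - 1) - 2 * φ x) (i, j)) =
      φ ((l.rowLen i : ℝ) - i) - φ ((l.rowLen i : ℝ) - i - 1) -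
        (φ (-(i : ℝ)) - φ (-((i + 1 : ℕ) : ℝ))) := by
    intro i _
    have := Finset.sum_range_sub (fun j : ℕ => φ ((j : ℝ) - i) - φ ((j : ℝ) - i - 1)) (l.rowLen i)
    simp only [Nat.cast_zero, zero_sub] at this
    have e : (-((i + 1 : ℕ) : ℝ)) = -(i : ℝ) - 1 := by push_cast; ring
    rw [e, ← this]
    refine Finset.sum_congr rfl fun j _ => ?_
    simp only [ct]
    push_cast
    ring_nf
  rw [Finset.sum_congr rfl h1, Finset.sum_congr rfl h2]
  simp only [Finset.sum_sub_distrib]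
  have h3 := Finset.sum_range_sub' (fun i : ℕ => φ (-(i : ℝ))) l.card
  have h4 := Finset.sum_range_sub (fun i : ℕ => φ ((l.rowLen i : ℝ) - i)) l.card
  simp only [Finset.sum_sub_distrib, Nat.cast_zero, neg_zero, sub_zero] at h3 h4
  rw [rowLen_eq_zero le_rfl] at h4
  simp only [Nat.cast_zero, zero_sub] at h4
  have e : ct φ (0, l.rowLen 0) = φ (l.rowLen 0) := by simp [ct]
  rw [e]
  linarith

theorem pw_row (K : ℕ) (l : YoungDiagram) :
    0 ≤ pw (fun c => if c.1 ≤ K then 1 else 0) l := by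
  rw [pw_eq]
  simp only [zero_le, if_true]
  have h : ∀ i ∈ Finset.range l.card, (if i = K then (-1 : ℝ) else 0) ≤
      (if l.rowLen (i + 1) < l.rowLen i then
        (if i + 1 ≤ K then (1 : ℝ) else 0) - (if i ≤ K then 1 else 0) else 0) := by
    intro i _
    split_ifs <;> first | omega | norm_num
  have := Finset.sum_le_sum h
  have h2 : (-1 : ℝ) ≤ ∑ i ∈ Finset.range l.card, (if i = K then (-1 : ℝ) else 0) := by
    rw [Finset.sum_ite_eq']
    split_ifs <;> norm_num
  linarith

theorem pw_one (l : YoungDiagram) : pw (fun _ => 1) l = 1 := by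
  rw [pw_eq]; simp

end
end PG

namespace PG
section
open scoped Classical

/-- SYT type -/
abbrev SYT (μ : YoungDiagram) := {T : μ.cells → Fin μ.card //
    Function.Bijective T ∧
      ∀ a b : μ.cells, (a : ℕ × ℕ).1 ≤ (b : ℕ × ℕ).1 → (a : ℕ × ℕ).2 ≤ (b : ℕ × ℕ).2 →
        a ≠ b → T a < T b}

theorem syt_bot : sytCount ⊥ = 1 := by
  have : Subsingleton (SYT ⊥) := by
    constructor
    rintro ⟨T, hT⟩ ⟨S, hS⟩
    apply Subtype.ext
    funext x
    exact absurd x.2 (Finset.notMem_empty _)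
  have h0 : SYT ⊥ := ⟨fun x => absurd x.2 (Finset.notMem_empty _), by
    constructor
    · constructor
      · intro x; exact absurd x.2 (Finset.notMem_empty _)
      · intro y; exact absurd y.2 (by simp [YoungDiagram.card])
    · intro x; exact absurd x.2 (Finset.notMem_empty _)⟩
  have : Unique (SYT ⊥) := uniqueOfSubsingleton h0
  exact Nat.card_unique

/-- extend a tableau -/
noncomputable def ext {μ κ : YoungDiagram} (h : κ ∈ dn μ) (T : κ.cells → Fin κ.card) :
    μ.cells → Fin μ.card := fun x =>
  if hx : x.1 ∈ κ.cells then ⟨(T ⟨x.1, hx⟩).val, by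
    have := (mem_dn.1 h).2; have := (T ⟨x.1, hx⟩).2; omega⟩
  else ⟨κ.card, by have := (mem_dn.1 h).2; omega⟩

theorem ext_in {μ κ : YoungDiagram} (h : κ ∈ dn μ) (T : κ.cells → Fin κ.card) (x : μ.cells)
    (hx : x.1 ∈ κ.cells) : (ext h T x).val = (T ⟨x.1, hx⟩).val := by
  simp [ext, hx]

theorem ext_out {μ κ : YoungDiagram} (h : κ ∈ dn μ) (T : κ.cells → Fin κ.card) (x : μ.cells)
    (hx : x.1 ∉ κ.cells) : (ext h T x).val = κ.card := by
  simp [ext, hx]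

theorem ext_in_iff {μ κ : YoungDiagram} (h : κ ∈ dn μ) (T : κ.cells → Fin κ.card) (x : μ.cells) :
    x.1 ∈ κ.cells ↔ (ext h T x).val < κ.card := by
  constructor
  · intro hx; rw [ext_in h T x hx]; exact (T _).2
  · intro hx; by_contra hc; rw [ext_out h T x hc] at hx; omega

theorem ext_syt {μ κ : YoungDiagram} (h : κ ∈ dn μ) (T : SYT κ) :
    Function.Bijective (ext h T.1) ∧
      ∀ a b : μ.cells, (a : ℕ × ℕ).1 ≤ (b : ℕ × ℕ).1 → (a : ℕ × ℕ).2 ≤ (b : ℕ × ℕ).2 →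
        a ≠ b → ext h T.1 a < ext h T.1 b := by
  obtain ⟨i, c1, c2, _⟩ := up_cell (mem_dn_iff.1 h)
  have huniq : ∀ x : μ.cells, x.1 ∉ κ.cells → x.1 = (i, κ.rowLen i) := by
    intro x hx
    have := x.2
    have h3 : x.1 ∈ insert (i, κ.rowLen i) κ.cells := c2 ▸ this
    exact (Finset.mem_insert.1 h3).resolve_right hx
  constructor
  · rw [Fintype.bijective_iff_injective_and_card]
    constructor
    · intro x y hxy
      by_cases hx : x.1 ∈ κ.cells
      · have hy : y.1 ∈ κ.cells := by
          rw [ext_in_iff h T.1, ← hxy, ← ext_in_iff h T.1]; exact hx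
        have h1 := congrArg Fin.val hxy
        rw [ext_in h T.1 x hx, ext_in h T.1 y hy] at h1
        have := T.2.1.1 (Fin.ext h1)
        apply Subtype.ext
        simpa using this
      · have hy : y.1 ∉ κ.cells := by
          rw [ext_in_iff h T.1, ← hxy, ← ext_in_iff h T.1]; exact hx
        apply Subtype.ext
        rw [huniq x hx, huniq y hy]
    · simp [YoungDiagram.card]
  · intro a b h1 h2 hab
    by_cases hb : b.1 ∈ κ.cells
    · have ha : a.1 ∈ κ.cells := κ.isLowerSet (show a.1 ≤ b.1 from ⟨h1, h2⟩) hb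
      rw [Fin.lt_def, ext_in h T.1 a ha, ext_in h T.1 b hb]
      refine T.2.2 ⟨a.1, ha⟩ ⟨b.1, hb⟩ h1 h2 ?_
      intro he
      apply hab
      apply Subtype.ext
      simpa using he
    · have ha : a.1 ∈ κ.cells := by
        by_contra hc
        exact hab (Subtype.ext (by rw [huniq a hc, huniq b hb]))
      rw [Fin.lt_def, ext_in h T.1 a ha, ext_out h T.1 b hb]
      exact (T.1 _).2

theorem syt_rec (μ : YoungDiagram) (hpos : 0 < μ.card) :
    sytCount μ = ∑ κ ∈ dn μ, sytCount κ := by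
  have hb : Function.Bijective (fun p : (Σ κ : dn μ, SYT κ.1) =>
      (⟨ext p.1.2 p.2.1, ext_syt p.1.2 p.2⟩ : SYT μ)) := by
    constructor
    · rintro ⟨⟨κ, hκ⟩, T⟩ ⟨⟨κ', hκ'⟩, T'⟩ heq
      have heq : ext hκ T.1 = ext hκ' T'.1 := congrArg Subtype.val heq
      have hc : κ.card = κ'.card := by
        have h1 := (mem_dn.1 hκ).2; have h2 := (mem_dn.1 hκ').2; omega
      have hk : κ = κ' := by
        apply cells_inj
        ext c
        constructor
        · intro h
          have hm : c ∈ μ.cells := YoungDiagram.cells_subset_iff.2 (mem_dn.1 hκ).1 h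
          rw [ext_in_iff hκ' T'.1 ⟨c, hm⟩, ← heq, ← hc, ← ext_in_iff hκ T.1 ⟨c, hm⟩]
          exact h
        · intro h
          have hm : c ∈ μ.cells := YoungDiagram.cells_subset_iff.2 (mem_dn.1 hκ').1 h
          rw [ext_in_iff hκ T.1 ⟨c, hm⟩, heq, hc, ← ext_in_iff hκ' T'.1 ⟨c, hm⟩]
          exact h
      subst hk
      congr 1
      apply Subtype.ext
      funext x
      have hm : x.1 ∈ μ.cells := YoungDiagram.cells_subset_iff.2 (mem_dn.1 hκ).1 x.2
      have := congrArg Fin.val (congrFun heq ⟨x.1, hm⟩)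
      rw [ext_in hκ T.1 ⟨x.1, hm⟩ x.2, ext_in hκ T'.1 ⟨x.1, hm⟩ x.2] at this
      exact Fin.ext this
    · rintro ⟨S, hS1, hS2⟩
      obtain ⟨c, hc⟩ := hS1.2 ⟨μ.card - 1, by omega⟩
      let κ : YoungDiagram := ⟨μ.cells.erase c.1, by
        intro b a hab hb
        simp only [Finset.coe_erase, Set.mem_sdiff, Finset.mem_coe, Set.mem_singleton_iff] at hb ⊢
        have ha : a ∈ μ.cells := μ.isLowerSet hab hb.1
        refine ⟨ha, ?_⟩
        intro hac
        have := hS2 c ⟨b, hb.1⟩ (hac ▸ hab.1 : c.1.1 ≤ b.1) (hac ▸ hab.2 : c.1.2 ≤ b.2)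
          (fun h => hb.2 (by rw [h]))
        rw [hc, Fin.lt_def] at this
        have h2 := (S ⟨b, hb.1⟩).2
        simp only at this
        omega⟩
      have hcard : μ.card = κ.card + 1 := by
        simp only [κ, YoungDiagram.card]
        rw [Finset.card_erase_of_mem c.2]
        simp only [YoungDiagram.card] at hpos
        omega
      have hsub : κ.cells ⊆ μ.cells := Finset.erase_subset _ _
      have hκ : κ ∈ dn μ := mem_dn.2 ⟨YoungDiagram.cells_subset_iff.1 hsub, hcard⟩
      have hne : ∀ x : κ.cells, (⟨x.1, hsub x.2⟩ : μ.cells) ≠ c := by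
        intro x h
        have := x.2
        have h' : x.1 = c.1 := congrArg Subtype.val h
        exact (Finset.mem_erase.1 this).1 h'
      have hlt : ∀ x : κ.cells, (S ⟨x.1, hsub x.2⟩).val < κ.card := by
        intro x
        have h1 := (S ⟨x.1, hsub x.2⟩).2
        have h2 : (S ⟨x.1, hsub x.2⟩).val ≠ μ.card - 1 := by
          intro h
          apply hne x
          apply hS1.1
          rw [hc]
          exact Fin.ext h
        omega
      let T : κ.cells → Fin κ.card := fun x => ⟨(S ⟨x.1, hsub x.2⟩).val, hlt x⟩
      have hT : Function.Bijective T ∧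
        ∀ a b : κ.cells, (a : ℕ × ℕ).1 ≤ (b : ℕ × ℕ).1 → (a : ℕ × ℕ).2 ≤ (b : ℕ × ℕ).2 →
          a ≠ b → T a < T b := by
        constructor
        · rw [Fintype.bijective_iff_injective_and_card]
          constructor
          · intro x y hxy
            have h1 : (S ⟨x.1, hsub x.2⟩).val = (S ⟨y.1, hsub y.2⟩).val := by
              have := congrArg Fin.val hxy
              exact this
            have := hS1.1 (Fin.ext h1)
            apply Subtype.ext
            simpa using this
          · simp [YoungDiagram.card]
        · intro a b h1 h2 hab
          refine hS2 ⟨a.1, hsub a.2⟩ ⟨b.1, hsub b.2⟩ h1 h2 ?_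
          intro he
          apply hab
          apply Subtype.ext
          simpa using he
      refine ⟨⟨⟨κ, hκ⟩, ⟨T, hT⟩⟩, ?_⟩
      apply Subtype.ext
      funext x
      apply Fin.ext
      simp only
      by_cases hx : x.1 ∈ κ.cells
      · rw [ext_in hκ T x hx]
      · rw [ext_out hκ T x hx]
        have : x = c := by
          by_contra hxc
          apply hx
          refine Finset.mem_erase.2 ⟨fun h => hxc (Subtype.ext h), x.2⟩
        rw [this, hc]
        simp only
        omega
  have h1 := Nat.card_congr (Equiv.ofBijective _ hb)
  change _ = sytCount μ at h1
  rw [← h1, Nat.card_sigma]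
  exact Finset.sum_coe_sort (dn μ) sytCount

/-- dimension as a real -/
noncomputable def d (μ : YoungDiagram) : ℝ := sytCount μ

theorem d_nonneg (μ : YoungDiagram) : 0 ≤ d μ := Nat.cast_nonneg _

theorem d_dn (μ : YoungDiagram) (h : 0 < μ.card) : ∑ κ ∈ dn μ, d κ = d μ := by
  simp only [d]
  rw [syt_rec μ h]
  push_cast
  rfl

theorem wt_one (μ : YoungDiagram) : wt (fun _ => 1) μ = μ.card := by
  simp [wt, YoungDiagram.card]

theorem comm_one (g : YoungDiagram → ℝ) (l : YoungDiagram) :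
    ∑ μ ∈ up l, ∑ ν ∈ dn μ, g ν = g l + ∑ κ ∈ dn l, ∑ ν ∈ up κ, g ν := by
  have h := comm (fun _ => 1) g l
  rw [pw_one, one_mul] at h
  simp only [wt_one] at h
  convert h using 2
  · refine Finset.sum_congr rfl fun ν _ => ?_
    rw [(mem_up.1 ‹_›).2]; push_cast; ring
  · refine Finset.sum_congr rfl fun κ _ => Finset.sum_congr rfl fun ν hν => ?_
    rw [(mem_up.1 hν).2]; push_cast; ring

theorem d_up_aux (n : ℕ) : ∀ l : YoungDiagram, l.card = n → ∑ μ ∈ up l, d μ = (n + 1) * d l := by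
  induction n with
  | zero =>
    intro l hl
    have h := comm_one d l
    have e : dn l = ∅ := by
      ext κ; simp [mem_dn]; omega
    rw [e, Finset.sum_empty] at h
    rw [Finset.sum_congr rfl fun μ hμ => d_dn μ (by rw [(mem_up.1 hμ).2]; omega)] at h
    simpa using h
  | succ n ih =>
    intro l hl
    have h := comm_one d l
    rw [Finset.sum_congr rfl fun μ hμ => d_dn μ (by rw [(mem_up.1 hμ).2]; omega)] at h
    rw [Finset.sum_congr rfl fun κ hκ => ih κ (by have := (mem_dn.1 hκ).2; omega),
      ← Finset.mul_sum, d_dn l (by omega)] at h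
    rw [h]; push_cast; ring

theorem d_up (l : YoungDiagram) : ∑ μ ∈ up l, d μ = (l.card + 1) * d l := d_up_aux _ l rfl

theorem Y_zero : Y 0 = {⊥} := by
  ext μ
  rw [mem_Y, Finset.mem_singleton]
  constructor
  · intro h
    apply cells_inj
    rw [YoungDiagram.cells_bot]
    exact Finset.card_eq_zero.1 h
  · rintro rfl; simp [YoungDiagram.card]

theorem sum_d_sq (n : ℕ) : ∑ μ ∈ Y n, d μ ^ 2 = n.factorial := by
  induction n with
  | zero => simp [Y_zero, d, syt_bot]
  | succ n ih =>
    have h : ∀ μ ∈ Y (n + 1), d μ ^ 2 = ∑ ν ∈ dn μ, d ν * d μ := by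
      intro μ hμ
      rw [← Finset.sum_mul, d_dn μ (by rw [mem_Y.1 hμ]; omega), sq]
    rw [Finset.sum_congr rfl h, ← sum_swap n (fun ν μ => d ν * d μ)]
    have h2 : ∀ ν ∈ Y n, ∑ μ ∈ up ν, d ν * d μ = (n + 1) * d ν ^ 2 := by
      intro ν hν
      rw [← Finset.mul_sum, d_up, mem_Y.1 hν]; ring
    rw [Finset.sum_congr rfl h2, ← Finset.mul_sum, ih, Nat.factorial_succ]
    push_cast; ring

end
end PG

namespace PG
section
open scoped Classical

noncomputable def EL (n : ℕ) (F : YoungDiagram → ℝ) : ℝ :=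
  (∑ μ ∈ Y n, F μ * d μ ^ 2) / n.factorial

noncomputable def ES (n : ℕ) (h : YoungDiagram → YoungDiagram → ℝ) : ℝ :=
  (∑ ν ∈ Y n, ∑ μ ∈ up ν, h ν μ * (d ν * d μ)) / (n + 1).factorial

theorem ES_left (n : ℕ) (F : YoungDiagram → ℝ) : ES n (fun ν _ => F ν) = EL n F := by
  rw [ES, EL]
  have h : ∀ ν ∈ Y n, ∑ μ ∈ up ν, F ν * (d ν * d μ) = (n + 1) * (F ν * d ν ^ 2) := by
    intro ν hν
    rw [← Finset.mul_sum, ← Finset.mul_sum, d_up, mem_Y.1 hν]; ring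
  rw [Finset.sum_congr rfl h, ← Finset.mul_sum, Nat.factorial_succ]
  have : (n.factorial : ℝ) ≠ 0 := by positivity
  push_cast
  field_simp

theorem ES_right (n : ℕ) (F : YoungDiagram → ℝ) : ES n (fun _ μ => F μ) = EL (n + 1) F := by
  rw [ES, EL, sum_swap n (fun ν μ => F μ * (d ν * d μ))]
  congr 1
  refine Finset.sum_congr rfl fun μ hμ => ?_
  rw [← Finset.mul_sum, ← Finset.sum_mul, d_dn μ (by rw [mem_Y.1 hμ]; omega)]; ring

theorem ES_congr {n : ℕ} {h h' : YoungDiagram → YoungDiagram → ℝ}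
    (H : ∀ ν μ, ν.card = n → μ ∈ up ν → h ν μ = h' ν μ) : ES n h = ES n h' := by
  rw [ES, ES]
  congr 1
  refine Finset.sum_congr rfl fun ν hν => Finset.sum_congr rfl fun μ hμ => ?_
  rw [H ν μ (mem_Y.1 hν) hμ]

theorem ES_mono {n : ℕ} {h h' : YoungDiagram → YoungDiagram → ℝ}
    (H : ∀ ν μ, ν.card = n → μ ∈ up ν → h ν μ ≤ h' ν μ) : ES n h ≤ ES n h' := by
  rw [ES, ES]
  refine div_le_div_of_nonneg_right ?_ (by positivity)
  refine Finset.sum_le_sum fun ν hν => Finset.sum_le_sum fun μ hμ => ?_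
  exact mul_le_mul_of_nonneg_right (H ν μ (mem_Y.1 hν) hμ) (mul_nonneg (d_nonneg _) (d_nonneg _))

theorem ES_add (n : ℕ) (h h' : YoungDiagram → YoungDiagram → ℝ) :
    ES n (fun ν μ => h ν μ + h' ν μ) = ES n h + ES n h' := by
  simp only [ES, add_mul, Finset.sum_add_distrib, add_div]

theorem ES_sub (n : ℕ) (h h' : YoungDiagram → YoungDiagram → ℝ) :
    ES n (fun ν μ => h ν μ - h' ν μ) = ES n h - ES n h' := by
  simp only [ES, sub_mul, Finset.sum_sub_distrib, sub_div]

theorem ES_smul (n : ℕ) (c : ℝ) (h : YoungDiagram → YoungDiagram → ℝ) :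
    ES n (fun ν μ => c * h ν μ) = c * ES n h := by
  simp only [ES, mul_assoc, ← Finset.mul_sum, mul_div_assoc]

theorem EL_const (n : ℕ) (c : ℝ) : EL n (fun _ => c) = c := by
  rw [EL, ← Finset.mul_sum, sum_d_sq]
  field_simp

theorem ES_const (n : ℕ) (c : ℝ) : ES n (fun _ _ => c) = c := by
  rw [ES_left n (fun _ => c), EL_const]

theorem EL_mono {n : ℕ} {F G : YoungDiagram → ℝ}
    (H : ∀ ν, ν.card = n → F ν ≤ G ν) : EL n F ≤ EL n G := by
  rw [EL, EL]
  refine div_le_div_of_nonneg_right ?_ (by positivity)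
  refine Finset.sum_le_sum fun ν hν => ?_
  exact mul_le_mul_of_nonneg_right (H ν (mem_Y.1 hν)) (sq_nonneg _)

theorem EL_add (n : ℕ) (F G : YoungDiagram → ℝ) :
    EL n (fun ν => F ν + G ν) = EL n F + EL n G := by
  simp only [EL, add_mul, Finset.sum_add_distrib, add_div]

theorem EL_smul (n : ℕ) (c : ℝ) (F : YoungDiagram → ℝ) :
    EL n (fun ν => c * F ν) = c * EL n F := by
  simp only [EL, mul_assoc, ← Finset.mul_sum, mul_div_assoc]

/-- expected weight of the box added from level `n` to level `n+1` -/
noncomputable def es (w : ℕ × ℕ → ℝ) (n : ℕ) : ℝ := ES n (fun ν μ => wt w μ - wt w ν)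

theorem EL_wt (w : ℕ × ℕ → ℝ) (n : ℕ) : EL n (wt w) = ∑ i ∈ Finset.range n, es w i := by
  induction n with
  | zero => simp [EL, Y_zero, wt]
  | succ n ih =>
    rw [Finset.sum_range_succ, ← ih, es, ES_sub, ES_right n (wt w), ES_left n (wt w)]; ring

theorem es_zero (w : ℕ × ℕ → ℝ) : es w 0 = EL 0 (pw w) := by
  have h0 : dn (⊥ : YoungDiagram) = ∅ := by
    ext κ; simp [mem_dn, YoungDiagram.card]
  have h1 : d ⊥ = 1 := by simp [d, syt_bot]
  have h2 : ∀ μ ∈ up ⊥, d μ = 1 := by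
    intro μ hμ
    have hc := (mem_up.1 hμ).2
    have e : dn μ = {⊥} := by
      ext κ
      rw [mem_dn, Finset.mem_singleton]
      constructor
      · rintro ⟨_, h⟩
        have : κ ∈ Y 0 := by
          rw [mem_Y]; simp only [YoungDiagram.card, YoungDiagram.cells_bot, Finset.card_empty] at *
          omega
        rw [Y_zero] at this
        simpa using this
      · rintro rfl; exact mem_up.1 hμ
    rw [← d_dn μ (by omega), e, Finset.sum_singleton, h1]
  simp only [es, ES, EL, Y_zero, Finset.sum_singleton, h1, pw, h0]
  rw [Finset.sum_congr rfl fun μ hμ => by rw [h2 μ hμ, mul_one, mul_one]]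
  norm_num

theorem es_succ (w : ℕ × ℕ → ℝ) (n : ℕ) :
    ((n : ℝ) + 2) * es w (n + 1) = EL (n + 1) (pw w) + (n + 1) * es w n := by
  have key : ∑ l ∈ Y (n + 1), ∑ μ ∈ up l, (wt w μ - wt w l) * (d l * d μ) =
      ∑ l ∈ Y (n + 1), pw w l * d l ^ 2 +
      (n + 1) * ∑ κ ∈ Y n, ∑ ν ∈ up κ, (wt w ν - wt w κ) * (d κ * d ν) := by
    have h1 : ∀ l ∈ Y (n + 1), ∑ μ ∈ up l, (wt w μ - wt w l) * (d l * d μ) =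
        pw w l * d l ^ 2 + ∑ κ ∈ dn l, d l * ∑ ν ∈ up κ, (wt w ν - wt w κ) * d ν := by
      intro l hl
      have h := comm w d l
      rw [← Finset.mul_sum]
      have e : ∑ μ ∈ up l, (wt w μ - wt w l) * (d l * d μ) =
          d l * ∑ μ ∈ up l, ∑ ν ∈ dn μ, (wt w μ - wt w l) * d ν := by
        rw [Finset.mul_sum]
        refine Finset.sum_congr rfl fun μ hμ => ?_
        rw [← Finset.mul_sum, d_dn μ (by rw [(mem_up.1 hμ).2]; omega)]; ring
      rw [e, h]; ring
    rw [Finset.sum_congr rfl h1, Finset.sum_add_distrib]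
    congr 1
    rw [← sum_swap n (fun κ l => d l * ∑ ν ∈ up κ, (wt w ν - wt w κ) * d ν), Finset.mul_sum]
    refine Finset.sum_congr rfl fun κ hκ => ?_
    rw [← Finset.sum_mul, d_up, mem_Y.1 hκ, mul_assoc, Finset.mul_sum]
    congr 1
    refine Finset.sum_congr rfl fun ν _ => by ring
  rw [es, es, ES, ES, EL, key, Nat.factorial_succ (n + 1)]
  have : ((n + 1).factorial : ℝ) ≠ 0 := by positivity
  push_cast
  field_simp
  ring

theorem es_sum (w : ℕ × ℕ → ℝ) (n : ℕ) :
    ((n : ℝ) + 1) * es w n = ∑ m ∈ Finset.range (n + 1), EL m (pw w) := by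
  induction n with
  | zero => simp [es_zero]
  | succ n ih =>
    rw [Finset.sum_range_succ, ← ih]
    have := es_succ w n
    push_cast
    linarith

/-- spectral gap -/
theorem gap (n : ℕ) : ∀ v : YoungDiagram → ℝ, ∑ μ ∈ Y (n + 1), v μ * d μ = 0 →
    ∑ ν ∈ Y n, (∑ μ ∈ up ν, v μ) ^ 2 ≤ n * ∑ μ ∈ Y (n + 1), v μ ^ 2 := by
  have hdual : ∀ (n : ℕ) (v g : YoungDiagram → ℝ), ∑ μ ∈ Y (n + 1), v μ * ∑ ν ∈ dn μ, g ν =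
      ∑ ν ∈ Y n, g ν * ∑ μ ∈ up ν, v μ := by
    intro n v g
    simp only [Finset.mul_sum]
    rw [sum_swap n (fun ν μ => g ν * v μ)]
    refine Finset.sum_congr rfl fun μ _ => Finset.sum_congr rfl fun ν _ => mul_comm _ _
  have hd : ∀ (n : ℕ) (v : YoungDiagram → ℝ), ∑ μ ∈ Y (n + 1), v μ * d μ =
      ∑ ν ∈ Y n, d ν * ∑ μ ∈ up ν, v μ := by
    intro n v
    rw [← hdual]
    refine Finset.sum_congr rfl fun μ hμ => ?_
    rw [d_dn μ (by rw [mem_Y.1 hμ]; omega)]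
  induction n with
  | zero =>
    intro v hv
    rw [hd, Y_zero, Finset.sum_singleton] at hv
    have h1 : d ⊥ = 1 := by simp [d, syt_bot]
    rw [h1, one_mul] at hv
    simp [Y_zero, hv]
  | succ n ih =>
    intro v hv
    set g : YoungDiagram → ℝ := fun ν => ∑ μ ∈ up ν, v μ with hg
    have hgd : ∑ ν ∈ Y (n + 1), g ν * d ν = 0 := by
      rw [hd] at hv
      rw [← hv]
      refine Finset.sum_congr rfl fun ν _ => mul_comm _ _
    have hgg : ∑ ν ∈ Y (n + 1), g ν ^ 2 = ∑ μ ∈ Y (n + 1 + 1), v μ * ∑ ν ∈ dn μ, g ν := by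
      rw [hdual]
      refine Finset.sum_congr rfl fun ν _ => sq _
    have hU : ∑ μ ∈ Y (n + 1 + 1), (∑ ν ∈ dn μ, g ν) ^ 2 =
        ∑ ν ∈ Y (n + 1), g ν ^ 2 + ∑ κ ∈ Y n, (∑ ν ∈ up κ, g ν) ^ 2 := by
      simp only [sq]
      rw [hdual (n + 1) (fun μ => ∑ ν ∈ dn μ, g ν) g]
      simp only [comm_one, mul_add, Finset.sum_add_distrib]
      congr 1
      rw [hdual n g (fun κ => ∑ ν ∈ up κ, g ν)]
    have hcs := Finset.sum_mul_sq_le_sq_mul_sq (Y (n + 1 + 1)) v (fun μ => ∑ ν ∈ dn μ, g ν)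
    rw [← hgg, hU] at hcs
    have hi := ih g hgd
    set G := ∑ ν ∈ Y (n + 1), g ν ^ 2 with hG
    have hG0 : 0 ≤ G := Finset.sum_nonneg fun _ _ => sq_nonneg _
    set V := ∑ μ ∈ Y (n + 1 + 1), v μ ^ 2 with hV
    have hV0 : 0 ≤ V := Finset.sum_nonneg fun _ _ => sq_nonneg _
    change G ≤ _
    push_cast
    have h2 : G ^ 2 ≤ V * ((n + 1) * G) :=
      hcs.trans (mul_le_mul_of_nonneg_left (by linarith) hV0)
    rcases hG0.eq_or_lt with h | h
    · rw [← h]; positivity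
    · by_contra hcon
      push Not at hcon
      have := mul_lt_mul_of_pos_right hcon h
      nlinarith

theorem variance_le (m : ℕ) (F : YoungDiagram → ℝ) :
    EL (m + 1) (fun μ => (F μ - EL (m + 1) F) ^ 2) ≤
      (m + 1) * ES m (fun ν μ => (F μ - F ν) ^ 2) := by
  set e := EL (m + 1) F with he
  have hfac : (0 : ℝ) < (m + 1).factorial := by positivity
  have hv : ∑ μ ∈ Y (m + 1), ((F μ - e) * d μ) * d μ = 0 := by
    have h1 : ∑ μ ∈ Y (m + 1), F μ * d μ ^ 2 = e * (m + 1).factorial := by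
      rw [he, EL]; field_simp
    have h2 := sum_d_sq (m + 1)
    calc _ = ∑ μ ∈ Y (m + 1), F μ * d μ ^ 2 - e * ∑ μ ∈ Y (m + 1), d μ ^ 2 := by
          rw [Finset.mul_sum, ← Finset.sum_sub_distrib]
          refine Finset.sum_congr rfl fun μ _ => by ring
      _ = 0 := by rw [h1, h2]; ring
  have hg := gap m (fun μ => (F μ - e) * d μ) hv
  have h3 : ((m : ℝ) + 1) * ∑ μ ∈ Y (m + 1), ((F μ - e) * d μ) ^ 2 =
      ∑ ν ∈ Y m, (∑ μ ∈ up ν, (F μ - e) ^ 2 * d μ) * (∑ μ ∈ up ν, d μ) := by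
    have : ∀ ν ∈ Y m, (∑ μ ∈ up ν, (F μ - e) ^ 2 * d μ) * (∑ μ ∈ up ν, d μ) =
        (m + 1) * ∑ μ ∈ up ν, (F μ - e) ^ 2 * d μ * d ν := by
      intro ν hν
      rw [d_up, mem_Y.1 hν, ← Finset.sum_mul]; ring
    rw [Finset.sum_congr rfl this, ← Finset.mul_sum,
      sum_swap m (fun ν μ => (F μ - e) ^ 2 * d μ * d ν)]
    congr 1
    refine Finset.sum_congr rfl fun μ hμ => ?_
    rw [← Finset.mul_sum, d_dn μ (by rw [mem_Y.1 hμ]; omega)]; ring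
  have h4 : ∀ ν ∈ Y m, (∑ μ ∈ up ν, (F μ - e) ^ 2 * d μ) * (∑ μ ∈ up ν, d μ) -
      (∑ μ ∈ up ν, (F μ - e) * d μ) ^ 2 ≤
      (m + 1) * ∑ μ ∈ up ν, (F μ - F ν) ^ 2 * (d ν * d μ) := by
    intro ν hν
    have e1 : ∑ μ ∈ up ν, (F μ - F ν) ^ 2 * (d ν * d μ) =
        d ν * (∑ μ ∈ up ν, (F μ - e) ^ 2 * d μ - 2 * (F ν - e) * (∑ μ ∈ up ν, (F μ - e) * d μ) +
          (F ν - e) ^ 2 * ∑ μ ∈ up ν, d μ) := by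
      simp only [Finset.mul_sum, ← Finset.sum_sub_distrib, ← Finset.sum_add_distrib]
      refine Finset.sum_congr rfl fun μ _ => by ring
    have e2 : (∑ μ ∈ up ν, d μ) = (m + 1) * d ν := by rw [d_up, mem_Y.1 hν]
    rw [e1, ← mul_assoc, ← e2]
    nlinarith [sq_nonneg ((∑ μ ∈ up ν, (F μ - e) * d μ) - (F ν - e) * ∑ μ ∈ up ν, d μ)]
  have h5 := Finset.sum_le_sum h4
  rw [Finset.sum_sub_distrib, ← h3, ← Finset.mul_sum] at h5
  have h6 : ∑ μ ∈ Y (m + 1), ((F μ - e) * d μ) ^ 2 ≤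
      (m + 1) * ∑ ν ∈ Y m, ∑ μ ∈ up ν, (F μ - F ν) ^ 2 * (d ν * d μ) := by linarith
  rw [EL, ES, ← mul_div_assoc]
  refine div_le_div_of_nonneg_right ?_ hfac.le
  simpa only [mul_pow] using h6

end
end PG

namespace PG
section
open scoped Classical

/-- content of the added box -/
noncomputable def cont (ν μ : YoungDiagram) : ℝ := wt (ct id) μ - wt (ct id) ν

theorem es_ct (φ : ℝ → ℝ) (n : ℕ) : es (ct φ) n = ES n (fun ν μ => φ (cont ν μ)) := by
  apply ES_congr
  intro ν μ _ h
  obtain ⟨i, h1, h2, _⟩ := up_cell h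
  simp only [cont]
  rw [wt_up h1 h2, wt_up h1 h2]
  rfl

theorem ES_sum {ι : Type*} (s : Finset ι) (n : ℕ) (h : ι → YoungDiagram → YoungDiagram → ℝ) :
    ES n (fun ν μ => ∑ i ∈ s, h i ν μ) = ∑ i ∈ s, ES n (h i) := by
  induction s using Finset.induction_on with
  | empty => simp [ES]
  | insert a s ha ih =>
    simp only [Finset.sum_insert ha]
    rw [ES_add, ih]

/-- moments of contents -/
noncomputable def mo (k n : ℕ) : ℝ := ES n (fun ν μ => cont ν μ ^ k)

/-- second difference of powers -/
noncomputable def dl (k : ℕ) (x : ℝ) : ℝ := (x + 1) ^ k + (x - 1) ^ k - 2 * x ^ k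

theorem dl_eq (k : ℕ) (x : ℝ) :
    dl k x = ∑ m ∈ Finset.range k, ((1 + (-1) ^ (k - m)) * (k.choose m : ℝ)) * x ^ m := by
  rw [dl, sub_eq_add_neg x 1, add_pow, add_pow, Finset.sum_range_succ, Finset.sum_range_succ]
  simp only [one_pow, mul_one, Nat.sub_self, pow_zero, Nat.choose_self, Nat.cast_one]
  have : ∀ m ∈ Finset.range k, ((1 + (-1) ^ (k - m)) * (k.choose m : ℝ)) * x ^ m =
      x ^ m * (k.choose m : ℝ) + x ^ m * (-1) ^ (k - m) * (k.choose m : ℝ) := by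
    intro m _; ring
  rw [Finset.sum_congr rfl this, Finset.sum_add_distrib]
  ring

theorem mo_rec (k n : ℕ) (hk : k ≠ 0) : ((n : ℝ) + 1) * mo k n =
    ∑ m ∈ Finset.range (n + 1), ∑ i ∈ Finset.range m, ES i (fun ν μ => dl k (cont ν μ)) := by
  have h := es_sum (ct fun x => x ^ k) n
  rw [es_ct] at h
  rw [mo, h]
  refine Finset.sum_congr rfl fun m _ => ?_
  have e : pw (ct fun x => x ^ k) = wt (ct (dl k)) := by
    funext l
    rw [pw_ct]
    simp only [zero_pow hk, zero_add]
    rfl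
  rw [e, EL_wt]
  refine Finset.sum_congr rfl fun i _ => ?_
  rw [es_ct]

theorem mo_odd (k : ℕ) : Odd k → ∀ n, mo k n = 0 := by
  induction k using Nat.strong_induction_on with
  | _ k ih =>
    intro hk n
    have hk0 : k ≠ 0 := by rintro rfl; simp at hk
    have h := mo_rec k n hk0
    have : ∀ i, ES i (fun ν μ => dl k (cont ν μ)) = 0 := by
      intro i
      simp only [dl_eq]
      rw [ES_sum]
      refine Finset.sum_eq_zero fun m hm => ?_
      rw [ES_smul]
      have hm := Finset.mem_range.1 hm
      rcases Nat.even_or_odd m with hme | hmo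
      · have : Odd (k - m) := Nat.Odd.sub_even hm.le hk hme
        rw [this.neg_one_pow]; simp
      · have := ih m hm hmo i
        rw [mo] at this
        rw [this, mul_zero]
    simp only [this, Finset.sum_const_zero] at h
    have hn : (n : ℝ) + 1 ≠ 0 := by positivity
    exact (mul_eq_zero.1 h).resolve_left hn

theorem dl_lower (k : ℕ) (x : ℝ) : ((2 * k + 2) * (2 * k + 1) : ℝ) * x ^ (2 * k) ≤ dl (2 * k + 2) x := by
  rw [dl_eq]
  have hnn : ∀ m ∈ Finset.range (2 * k + 2),
      0 ≤ ((1 + (-1) ^ (2 * k + 2 - m)) * ((2 * k + 2).choose m : ℝ)) * x ^ m := by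
    intro m hm
    have hm := Finset.mem_range.1 hm
    rcases Nat.even_or_odd m with hme | hmo
    · have : Even (2 * k + 2 - m) := by
        refine (Nat.even_sub hm.le).2 ?_
        simp [hme, parity_simps]
      rw [this.neg_one_pow]
      have := hme.pow_nonneg x
      positivity
    · have : Odd (2 * k + 2 - m) := by
        obtain ⟨a, rfl⟩ := hmo
        exact ⟨k - a, by omega⟩
      rw [this.neg_one_pow]; simp
  refine le_trans (le_of_eq ?_) (Finset.single_le_sum hnn (Finset.mem_range.2 (show 2 * k < _ by omega)))
  have e : (2 * k + 2).choose (2 * k) = (2 * k + 2).choose 2 := by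
    rw [← Nat.choose_symm_of_eq_add (show 2 * k + 2 = 2 + 2 * k by omega)]
  have e2 : 2 * k + 2 - 2 * k = 2 := by omega
  rw [e, e2, Nat.cast_choose_two]
  push_cast; ring

theorem dl_upper (k : ℕ) : ∃ B : ℝ, 0 ≤ B ∧ ∀ x, dl (2 * k + 2) x ≤ B * (x ^ (2 * k) + 1) := by
  refine ⟨∑ m ∈ Finset.range (2 * k + 1), 2 * ((2 * k + 2).choose m : ℝ), by positivity, ?_⟩
  intro x
  rw [dl_eq, Finset.sum_range_succ, Finset.sum_mul]
  have e2 : 2 * k + 2 - (2 * k + 1) = 1 := by omega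
  have : (1 + (-1) ^ (2 * k + 2 - (2 * k + 1)) : ℝ) = 0 := by rw [e2]; norm_num
  rw [this, zero_mul, zero_mul, add_zero]
  refine Finset.sum_le_sum fun m hm => ?_
  have hm := Finset.mem_range.1 hm
  have h1 : |x ^ m| ≤ x ^ (2 * k) + 1 := by
    have he : x ^ (2 * k) = |x| ^ (2 * k) := by rw [pow_mul, pow_mul, sq_abs]
    rw [he, abs_pow]
    rcases le_total |x| 1 with h | h
    · have := pow_le_one₀ (n := m) (abs_nonneg x) h
      have := pow_nonneg (abs_nonneg x) (2 * k)
      linarith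
    · have := pow_le_pow_right₀ h (show m ≤ 2 * k by omega)
      linarith
  have h2 : |1 + (-1 : ℝ) ^ (2 * k + 2 - m)| ≤ 2 := by
    rcases neg_one_pow_eq_or ℝ (2 * k + 2 - m) with h | h <;> rw [h] <;> norm_num
  refine (le_abs_self _).trans ?_
  rw [abs_mul, abs_mul, Nat.abs_cast]
  gcongr

theorem mo_zero (n : ℕ) : mo 0 n = 1 := by
  simp only [mo, pow_zero]; exact ES_const n 1

theorem mo_upper (k : ℕ) : ∃ C : ℝ, 0 ≤ C ∧ ∀ n : ℕ, mo (2 * k) n ≤ C * ((n : ℝ) + 1) ^ k := by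
  induction k with
  | zero => exact ⟨1, zero_le_one, fun n => by simp [mo_zero]⟩
  | succ k ih =>
    obtain ⟨C, hC, h⟩ := ih
    obtain ⟨B, hB, hb⟩ := dl_upper k
    refine ⟨B * (C + 1), by positivity, fun n => ?_⟩
    have hr := mo_rec (2 * (k + 1)) n (by omega)
    have h1 : ∀ i < n, ES i (fun ν μ => dl (2 * (k + 1)) (cont ν μ)) ≤
        B * (C + 1) * ((n : ℝ) + 1) ^ k := by
      intro i hi
      have : ES i (fun ν μ => dl (2 * (k + 1)) (cont ν μ)) ≤
          ES i (fun ν μ => B * (cont ν μ ^ (2 * k) + 1)) := ES_mono fun ν μ _ _ => hb _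
      refine this.trans ?_
      rw [ES_smul, ES_add, ES_const, mul_assoc]
      refine mul_le_mul_of_nonneg_left ?_ hB
      have h2 : ES i (fun ν μ => cont ν μ ^ (2 * k)) ≤ C * ((i : ℝ) + 1) ^ k := h i
      have hi' : (i : ℝ) ≤ n := by exact_mod_cast hi.le
      have h3 : ((i : ℝ) + 1) ^ k ≤ ((n : ℝ) + 1) ^ k := by gcongr
      have h4 : (1 : ℝ) ≤ ((n : ℝ) + 1) ^ k := one_le_pow₀ (by linarith [n.cast_nonneg (α := ℝ)])
      nlinarith
    have h2 : ∀ m ∈ Finset.range (n + 1), ∑ i ∈ Finset.range m,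
        ES i (fun ν μ => dl (2 * (k + 1)) (cont ν μ)) ≤ (n + 1) * (B * (C + 1) * ((n : ℝ) + 1) ^ k) := by
      intro m hm
      have hm := Finset.mem_range.1 hm
      refine (Finset.sum_le_card_nsmul _ _ _ fun i hi => h1 i ?_).trans ?_
      · have := Finset.mem_range.1 hi; omega
      · rw [Finset.card_range, nsmul_eq_mul]
        have : (m : ℝ) ≤ n + 1 := by exact_mod_cast hm.le
        exact mul_le_mul_of_nonneg_right this (by positivity)
    have h3 := Finset.sum_le_card_nsmul _ _ _ h2
    rw [← hr, Finset.card_range, nsmul_eq_mul] at h3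
    push_cast at h3
    have hn : (0 : ℝ) < n + 1 := by positivity
    have h4 := le_of_mul_le_mul_left h3 hn
    rw [pow_succ]
    linarith

theorem sum_choose_real (n k : ℕ) :
    ∑ i ∈ Finset.range n, ((i.choose k : ℕ) : ℝ) = ((n.choose (k + 1) : ℕ) : ℝ) := by
  induction n with
  | zero => simp
  | succ n ih =>
    rw [Finset.sum_range_succ, ih, Nat.choose_succ_succ']; push_cast; ring

theorem mo_lower (k : ℕ) : ∀ n : ℕ,
    (k.centralBinom : ℝ) / (k + 1) * (k.factorial * (n.choose k : ℝ)) ≤ mo (2 * k) n := by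
  induction k with
  | zero => intro n; simp [mo_zero]
  | succ k ih =>
    intro n
    have hr := mo_rec (2 * (k + 1)) n (by omega)
    have h1 : ∀ i, ((2 * k + 2) * (2 * k + 1) : ℝ) *
        ((k.centralBinom : ℝ) / (k + 1) * (k.factorial * (i.choose k : ℝ))) ≤
        ES i (fun ν μ => dl (2 * (k + 1)) (cont ν μ)) := by
      intro i
      have : ES i (fun ν μ => ((2 * k + 2) * (2 * k + 1) : ℝ) * (cont ν μ ^ (2 * k))) ≤
          ES i (fun ν μ => dl (2 * (k + 1)) (cont ν μ)) := ES_mono fun ν μ _ _ => dl_lower k _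
      refine le_trans ?_ this
      rw [ES_smul]
      exact mul_le_mul_of_nonneg_left (ih i) (by positivity)
    have h2 : ∑ m ∈ Finset.range (n + 1), ∑ i ∈ Finset.range m, (((2 * k + 2) * (2 * k + 1) : ℝ) *
        ((k.centralBinom : ℝ) / (k + 1) * (k.factorial * (i.choose k : ℝ)))) ≤
        ((n : ℝ) + 1) * mo (2 * (k + 1)) n := by
      rw [hr]
      exact Finset.sum_le_sum fun m _ => Finset.sum_le_sum fun i _ => h1 i
    simp only [← Finset.mul_sum, sum_choose_real] at h2
    have h3 : ((n : ℝ) + 1) * (n.choose (k + 1) : ℝ) = ((n + 1).choose (k + 2) : ℝ) * (k + 2) := by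
      exact_mod_cast Nat.add_one_mul_choose_eq n (k + 1)
    have h4 : ((k : ℝ) + 1) * (k + 1).centralBinom = 2 * (2 * k + 1) * k.centralBinom := by
      exact_mod_cast Nat.succ_mul_centralBinom_succ k
    have hn : (0 : ℝ) < n + 1 := by positivity
    refine le_of_mul_le_mul_left (le_trans (le_of_eq ?_) h2) hn
    rw [Nat.factorial_succ]
    push_cast
    have hk1 : (k : ℝ) + 1 ≠ 0 := by positivity
    have hk2 : (k : ℝ) + 1 + 1 ≠ 0 := by positivity
    calc ((n : ℝ) + 1) * (((k + 1).centralBinom : ℝ) / (k + 1 + 1) *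
          ((k + 1) * k.factorial * (n.choose (k + 1) : ℝ)))
        = (((k : ℝ) + 1) * (k + 1).centralBinom) * k.factorial *
          (((n : ℝ) + 1) * (n.choose (k + 1) : ℝ)) / (k + 1 + 1) := by ring
      _ = _ := by
        rw [h3, h4]
        have : (k : ℝ) + 2 = k + 1 + 1 := by ring
        rw [this]
        field_simp

end
end PG

namespace PG
section
open scoped Classical

noncomputable def wK (K : ℕ) : ℕ × ℕ → ℝ := fun c => if c.1 ≤ K then 1 else 0

/-- indicator that the added box is in row `≤ K` -/
noncomputable def R (K : ℕ) (ν μ : YoungDiagram) : ℝ := wt (wK K) μ - wt (wK K) ν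

noncomputable def q (K n : ℕ) : ℝ := es (wK K) n

theorem q_eq (K n : ℕ) : q K n = ES n (R K) := rfl

theorem R_zero_or_one {K : ℕ} {ν μ : YoungDiagram} (h : μ ∈ up ν) : R K ν μ = 0 ∨ R K ν μ = 1 := by
  obtain ⟨i, h1, h2, _⟩ := up_cell h
  rw [R, wt_up h1 h2, wK]
  by_cases hh : i ≤ K <;> simp [hh]

theorem R_sq {K : ℕ} {ν μ : YoungDiagram} (h : μ ∈ up ν) : R K ν μ ^ 2 = R K ν μ := by
  rcases R_zero_or_one (K := K) h with h | h <;> simp [h]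

theorem R_nonneg {K : ℕ} {ν μ : YoungDiagram} (h : μ ∈ up ν) : 0 ≤ R K ν μ := by
  rcases R_zero_or_one (K := K) h with h | h <;> simp [h]

theorem R_zero_cont {K : ℕ} {ν μ : YoungDiagram} (h : μ ∈ up ν) (h0 : R K ν μ = 0) :
    ((K : ℝ) + 1) * cont ν μ ≤ wt (wK K) ν := by
  obtain ⟨i, h1, h2, _⟩ := up_cell h
  rw [R, wt_up h1 h2, wK] at h0
  have hi : K < i := by
    by_contra hh
    simp [not_lt.1 hh] at h0
  rw [cont, wt_up h1 h2]
  have hs : Finset.range (K + 1) ×ˢ Finset.range (ν.rowLen i) ⊆ ν.cells := by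
    rintro ⟨a, b⟩ hab
    simp only [Finset.mem_product, Finset.mem_range] at hab
    have : (i, b) ∈ ν := YoungDiagram.mem_iff_lt_rowLen.2 hab.2
    exact YoungDiagram.mem_cells _ |>.2 (ν.up_left_mem (by omega) le_rfl this)
  have h3 : ∑ c ∈ Finset.range (K + 1) ×ˢ Finset.range (ν.rowLen i), wK K c ≤ wt (wK K) ν := by
    refine Finset.sum_le_sum_of_subset_of_nonneg hs fun c _ _ => ?_
    simp only [wK]; split_ifs <;> simp
  have h4 : ∑ c ∈ Finset.range (K + 1) ×ˢ Finset.range (ν.rowLen i), wK K c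
      = ((K : ℝ) + 1) * ν.rowLen i := by
    rw [Finset.sum_congr rfl (g := fun _ => (1 : ℝ))]
    · simp
    · rintro ⟨a, b⟩ hab
      simp only [Finset.mem_product, Finset.mem_range] at hab
      simp [wK, show a ≤ K by omega]
  rw [h4] at h3
  refine le_trans (mul_le_mul_of_nonneg_left ?_ (by positivity)) h3
  simp [ct]

theorem card_filter_le (s : Finset ℕ) (K : ℕ) : (s.filter (fun i => i ≤ K)).card ≤ K + 1 := by
  have : (s.filter (fun i => i ≤ K)).card ≤ (Finset.range (K + 1)).card :=
    Finset.card_le_card (fun i hi => by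
      simp only [Finset.mem_filter, Finset.mem_range] at hi ⊢; omega)
  rwa [Finset.card_range] at this

theorem sum_up_R (K : ℕ) (l : YoungDiagram) : ∑ μ ∈ up l, R K l μ ≤ (K : ℝ) + 1 := by
  simp only [R]
  rw [sum_up]
  simp only [wK]
  rw [← Finset.sum_filter, Finset.sum_const, nsmul_eq_mul, mul_one]
  exact_mod_cast card_filter_le _ K

theorem sum_dn_R (K : ℕ) (l : YoungDiagram) : ∑ κ ∈ dn l, R K κ l ≤ (K : ℝ) + 1 := by
  simp only [R]
  rw [sum_dn]
  simp only [wK]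
  rw [← Finset.sum_filter, Finset.sum_const, nsmul_eq_mul, mul_one]
  exact_mod_cast card_filter_le _ K

noncomputable def U (K : ℕ) (μ : YoungDiagram) : ℝ := ∑ ν ∈ dn μ, R K ν μ * d ν

theorem U_nonneg (K : ℕ) (μ : YoungDiagram) : 0 ≤ U K μ :=
  Finset.sum_nonneg fun _ hν => mul_nonneg (R_nonneg (mem_dn_iff.1 hν)) (d_nonneg _)

theorem sum_U_sq (K n : ℕ) : ∑ μ ∈ Y (n + 1), U K μ ^ 2 ≤ ((K : ℝ) + 1) ^ 2 * n.factorial := by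
  have h1 : ∀ μ ∈ Y (n + 1), U K μ ^ 2 ≤ (K + 1) * ∑ ν ∈ dn μ, R K ν μ * d ν ^ 2 := by
    intro μ _
    have e : U K μ = ∑ ν ∈ dn μ, R K ν μ * (R K ν μ * d ν) := by
      refine Finset.sum_congr rfl fun ν hν => ?_
      rw [← mul_assoc, ← pow_two, R_sq (mem_dn_iff.1 hν)]
    have h := Finset.sum_mul_sq_le_sq_mul_sq (dn μ) (fun ν => R K ν μ) (fun ν => R K ν μ * d ν)
    rw [e]
    refine h.trans ?_
    have e1 : ∑ ν ∈ dn μ, R K ν μ ^ 2 = ∑ ν ∈ dn μ, R K ν μ :=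
      Finset.sum_congr rfl fun ν hν => R_sq (mem_dn_iff.1 hν)
    have e2 : ∑ ν ∈ dn μ, (R K ν μ * d ν) ^ 2 = ∑ ν ∈ dn μ, R K ν μ * d ν ^ 2 :=
      Finset.sum_congr rfl fun ν hν => by rw [mul_pow, R_sq (mem_dn_iff.1 hν)]
    rw [e1, e2]
    refine mul_le_mul_of_nonneg_right (sum_dn_R K μ) ?_
    exact Finset.sum_nonneg fun ν hν => mul_nonneg (R_nonneg (mem_dn_iff.1 hν)) (sq_nonneg _)
  refine (Finset.sum_le_sum h1).trans ?_
  rw [← Finset.mul_sum, ← sum_swap n (fun ν μ => R K ν μ * d ν ^ 2)]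
  have h2 : ∀ ν ∈ Y n, ∑ μ ∈ up ν, R K ν μ * d ν ^ 2 ≤ (K + 1) * d ν ^ 2 := by
    intro ν _
    rw [← Finset.sum_mul]
    exact mul_le_mul_of_nonneg_right (sum_up_R K ν) (sq_nonneg _)
  have h3 := Finset.sum_le_sum h2
  rw [← Finset.mul_sum, sum_d_sq] at h3
  calc _ ≤ ((K : ℝ) + 1) * ((K + 1) * n.factorial) := mul_le_mul_of_nonneg_left h3 (by positivity)
    _ = _ := by ring

theorem sum_U_d (K n : ℕ) : ∑ μ ∈ Y (n + 1), U K μ * d μ = (n + 1).factorial * q K n := by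
  rw [q_eq, ES, sum_swap n (fun ν μ => R K ν μ * (d ν * d μ))]
  have : ((n + 1).factorial : ℝ) ≠ 0 := by positivity
  rw [mul_div_cancel₀ _ this]
  refine Finset.sum_congr rfl fun μ _ => ?_
  rw [U, Finset.sum_mul]
  exact Finset.sum_congr rfl fun ν _ => by ring

theorem q_nonneg (K n : ℕ) : 0 ≤ q K n := by
  have := ES_mono (n := n) (h := fun _ _ => 0) (h' := R K) (fun ν μ _ h => R_nonneg h)
  rwa [ES_const] at this

theorem q_sq_le (K n : ℕ) : q K n ^ 2 * (n + 1) ≤ ((K : ℝ) + 1) ^ 2 := by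
  have h := Finset.sum_mul_sq_le_sq_mul_sq (Y (n + 1)) (U K) d
  rw [sum_U_d, sum_d_sq] at h
  have h2 := h.trans (mul_le_mul_of_nonneg_right (sum_U_sq K n) (by positivity))
  have hn : (0 : ℝ) < n.factorial := by positivity
  rw [Nat.factorial_succ] at h2
  push_cast at h2
  have hp : (0 : ℝ) < (n + 1) * n.factorial ^ 2 := by positivity
  refine le_of_mul_le_mul_left (le_trans (le_of_eq ?_) (h2.trans (le_of_eq ?_))) hp <;> ring

theorem q_le (K n : ℕ) : q K n * Real.sqrt (n + 1) ≤ (K : ℝ) + 1 := by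
  refine le_of_sq_le_sq ?_ (by positivity)
  rw [mul_pow, Real.sq_sqrt (by positivity)]
  exact q_sq_le K n

theorem q_mono (K : ℕ) : Monotone (fun n : ℕ => ((n : ℝ) + 1) * q K n) := by
  refine monotone_nat_of_le_succ fun n => ?_
  have h := es_succ (wK K) n
  have h2 := EL_mono (n := n + 1) (F := fun _ => 0) (G := pw (wK K)) (fun ν _ => pw_row K ν)
  rw [EL_const] at h2
  simp only [q]
  push_cast
  linarith

theorem L2_bound (K n : ℕ) :
    (∑ μ ∈ Y (n + 1), |U K μ * d μ / (n + 1).factorial -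
      (K + 1) / Real.sqrt (n + 1) * (d μ ^ 2 / (n + 1).factorial)|) ^ 2 * (n + 1) ≤
      2 * (K + 1) * (K + 1 - Real.sqrt (n + 1) * q K n) := by
  set s : ℝ := (K + 1) / Real.sqrt (n + 1) with hs
  have hf : (0 : ℝ) < (n + 1).factorial := by positivity
  have hn : (0 : ℝ) < (n : ℝ) + 1 := by positivity
  have e : ∑ μ ∈ Y (n + 1), |U K μ * d μ / (n + 1).factorial - s * (d μ ^ 2 / (n + 1).factorial)| =
      (∑ μ ∈ Y (n + 1), d μ * |U K μ - s * d μ|) / (n + 1).factorial := by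
    rw [Finset.sum_div]
    refine Finset.sum_congr rfl fun μ _ => ?_
    rw [← abs_of_nonneg (d_nonneg μ), ← abs_mul, ← abs_of_pos hf, ← abs_div,
      abs_of_nonneg (d_nonneg μ), abs_of_pos hf]
    congr 1
    ring
  rw [e]
  have h := Finset.sum_mul_sq_le_sq_mul_sq (Y (n + 1)) d (fun μ => |U K μ - s * d μ|)
  rw [sum_d_sq] at h
  have h1 : ∑ μ ∈ Y (n + 1), |U K μ - s * d μ| ^ 2 ≤
      (K + 1) ^ 2 * n.factorial - 2 * s * ((n + 1).factorial * q K n) + s ^ 2 * (n + 1).factorial := by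
    have : ∀ μ ∈ Y (n + 1), |U K μ - s * d μ| ^ 2 =
        U K μ ^ 2 - 2 * s * (U K μ * d μ) + s ^ 2 * d μ ^ 2 := by
      intro μ _
      rw [sq_abs]; ring
    rw [Finset.sum_congr rfl this, Finset.sum_add_distrib, Finset.sum_sub_distrib, ← Finset.mul_sum,
      ← Finset.mul_sum, sum_U_d, sum_d_sq]
    linarith [sum_U_sq K n]
  have h2 := h.trans (mul_le_mul_of_nonneg_left h1 hf.le)
  rw [div_pow, div_mul_eq_mul_div, div_le_iff₀ (by positivity)]
  have hsq := Real.sq_sqrt hn.le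
  set r := Real.sqrt ((n : ℝ) + 1) with hr
  have hrpos : 0 < r := Real.sqrt_pos.2 hn
  have hfac : ((n + 1).factorial : ℝ) = r ^ 2 * n.factorial := by
    rw [Nat.factorial_succ, hsq]; push_cast; ring
  rw [hfac] at h2 ⊢
  rw [← hsq]
  refine (mul_le_mul_of_nonneg_right h2 (sq_nonneg r)).trans (le_of_eq ?_)
  rw [hs]
  field_simp
  ring

theorem var_le (K n : ℕ) : EL n (fun μ => (wt (wK K) μ - EL n (wt (wK K))) ^ 2) ≤
    (K + 1) * Real.sqrt n := by
  cases n with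
  | zero =>
    have : EL 0 (wt (wK K)) = 0 := by rw [EL_wt]; simp
    rw [this]
    simp [EL, Y_zero, wt]
  | succ m =>
    refine (variance_le m (wt (wK K))).trans ?_
    have : ES m (fun ν μ => (wt (wK K) μ - wt (wK K) ν) ^ 2) = q K m :=
      ES_congr fun ν μ _ h => R_sq h
    rw [this]
    have h := q_le K m
    push_cast
    have h0 : (0 : ℝ) ≤ (m : ℝ) + 1 := by positivity
    have hsq := Real.mul_self_sqrt h0
    calc ((m : ℝ) + 1) * q K m = (q K m * Real.sqrt (m + 1)) * Real.sqrt (m + 1) := by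
          rw [mul_assoc, hsq, mul_comm]
      _ ≤ _ := mul_le_mul_of_nonneg_right h (Real.sqrt_nonneg _)

end
end PG

namespace PG
section
open scoped Classical

noncomputable def bad (K : ℕ) (x : ℝ) (ν : YoungDiagram) : ℝ :=
  if (K + 1) * x < wt (wK K) ν then 1 else 0

theorem ptwise (k : ℕ) (x t c r b : ℝ) (hx : 0 < x) (ht : 0 < t) (hr : r = 0 ∨ r = 1)
    (hb : b = 0 ∨ b = 1) (h : r = 0 → b = 0 → c ≤ x) :
    x * c ^ (2 * k) + c ^ (2 * k + 1) ≤
      2 * x ^ (2 * k + 1) + (t * c ^ (2 * (2 * k + 1)) + 2 / t * (r + b)) := by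
  have hc2 : 0 ≤ c ^ (2 * k) := (even_two_mul k).pow_nonneg c
  have hc4 : 0 ≤ c ^ (2 * (2 * k + 1)) := (even_two_mul _).pow_nonneg c
  have hrb : 0 ≤ r + b := by rcases hr with rfl | rfl <;> rcases hb with rfl | rfl <;> norm_num
  have htt : 0 ≤ t * c ^ (2 * (2 * k + 1)) + 2 / t * (r + b) := by positivity
  have e1 : x * c ^ (2 * k) + c ^ (2 * k + 1) = c ^ (2 * k) * (x + c) := by ring
  rw [e1]
  by_cases hcx : |c| ≤ x
  · have h1 : c ^ (2 * k) ≤ x ^ (2 * k) := by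
      rw [← (even_two_mul k).pow_abs]
      exact pow_le_pow_left₀ (abs_nonneg _) hcx _
    have h2 : x + c ≤ 2 * x := by linarith [le_abs_self c]
    have h3 : 0 ≤ x + c := by linarith [neg_abs_le c]
    calc c ^ (2 * k) * (x + c) ≤ x ^ (2 * k) * (2 * x) := by gcongr
      _ = 2 * x ^ (2 * k + 1) := by ring
      _ ≤ _ := by linarith
  · push Not at hcx
    by_cases h0 : r = 0 ∧ b = 0
    · have hcl := h h0.1 h0.2
      have : c < -x := by
        by_contra hh
        push Not at hh
        exact absurd (abs_le.2 ⟨hh, hcl⟩) (not_le.2 hcx)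
      have h1 : c ^ (2 * k) * (x + c) ≤ 0 := mul_nonpos_of_nonneg_of_nonpos hc2 (by linarith)
      have : 0 < x ^ (2 * k + 1) := by positivity
      linarith
    · have hB : (1 : ℝ) ≤ r + b := by
        rcases hr with rfl | rfl <;> rcases hb with rfl | rfl <;>
          first | exact absurd ⟨rfl, rfl⟩ h0 | norm_num
      have h1 : c ^ (2 * k) * (x + c) ≤ 2 * |c| ^ (2 * k + 1) := by
        rw [← (even_two_mul k).pow_abs]
        calc |c| ^ (2 * k) * (x + c) ≤ |c| ^ (2 * k) * (|c| + |c|) := by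
              gcongr; exact le_abs_self c
          _ = _ := by ring
      have h2 : 2 * |c| ^ (2 * k + 1) ≤ t * c ^ (2 * (2 * k + 1)) + 1 / t := by
        have e : c ^ (2 * (2 * k + 1)) = (|c| ^ (2 * k + 1)) ^ 2 := by
          rw [← (even_two_mul (2 * k + 1)).pow_abs, ← pow_mul, mul_comm]
        rw [e]
        set z := |c| ^ (2 * k + 1)
        have : 0 ≤ (t * z - 1) ^ 2 / t := by positivity
        have e2 : (t * z - 1) ^ 2 / t = t * z ^ 2 + 1 / t - 2 * z := by field_simp; ring
        linarith
      have h3 : 1 / t ≤ 2 / t * (r + b) := by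
        rw [div_mul_eq_mul_div]
        gcongr
        linarith
      have : 0 < x ^ (2 * k + 1) := by positivity
      linarith

theorem main_ineq (K n k : ℕ) (x t : ℝ) (hx : 0 < x) (ht : 0 < t) :
    x * mo (2 * k) n ≤ 2 * x ^ (2 * k + 1) +
      (t * mo (2 * (2 * k + 1)) n + 2 / t * (q K n + EL n (bad K x))) := by
  have h := ES_mono (n := n)
    (h := fun ν μ => x * cont ν μ ^ (2 * k) + cont ν μ ^ (2 * k + 1))
    (h' := fun ν μ => 2 * x ^ (2 * k + 1) + (t * cont ν μ ^ (2 * (2 * k + 1)) +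
      2 / t * (R K ν μ + bad K x ν))) (by
    intro ν μ _ hμ
    refine ptwise k x t (cont ν μ) (R K ν μ) (bad K x ν) hx ht (R_zero_or_one hμ) ?_ ?_
    · rw [bad]; split_ifs <;> simp
    · intro h0 h1
      have h2 := R_zero_cont hμ h0
      have h3 : wt (wK K) ν ≤ (K + 1) * x := by
        by_contra hh
        rw [bad, if_pos (not_le.1 hh)] at h1
        exact one_ne_zero h1
      exact le_of_mul_le_mul_left (h2.trans h3) (by positivity))
  rw [ES_add, ES_add, ES_add, ES_smul, ES_const, ES_smul, ES_smul n (2 / t), ES_add,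
    ES_left n (bad K x)] at h
  have ho := mo_odd (2 * k + 1) ⟨k, rfl⟩ n
  simp only [mo] at ho ⊢
  rw [ho] at h
  rw [q_eq]
  linarith

theorem cheb (K n : ℕ) (x y : ℝ) (hxy : y < x) (hE : EL n (wt (wK K)) ≤ (K + 1) * y) :
    EL n (bad K x) ≤ Real.sqrt n / (x - y) ^ 2 := by
  have hK : (1 : ℝ) ≤ (K : ℝ) + 1 := by simp
  have hd : 0 < x - y := by linarith
  set e := EL n (wt (wK K)) with he
  have h : EL n (bad K x) ≤ EL n (fun μ => (1 / ((K + 1) * (x - y)) ^ 2) * (wt (wK K) μ - e) ^ 2) := by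
    refine EL_mono fun ν _ => ?_
    rw [bad]
    split_ifs with hh
    · rw [one_div_mul_eq_div, le_div_iff₀ (by positivity), one_mul]
      refine pow_le_pow_left₀ (by positivity) ?_ 2
      linarith
    · positivity
  rw [EL_smul] at h
  refine h.trans ?_
  have h2 := var_le K n
  refine (mul_le_mul_of_nonneg_left h2 (by positivity)).trans ?_
  rw [one_div_mul_eq_div, mul_pow, div_le_div_iff₀ (by positivity) (by positivity)]
  have hs := Real.sqrt_nonneg n
  have : 0 ≤ Real.sqrt n * (x - y) ^ 2 := by positivity
  nlinarith [mul_nonneg this (show (0 : ℝ) ≤ (K + 1) ^ 2 - (K + 1) by nlinarith)]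

theorem mo_lower' (k n : ℕ) (hn : 2 * k ^ 2 ≤ n) :
    (k.centralBinom : ℝ) / (k + 1) * ((n : ℝ) ^ k / 2) ≤ mo (2 * k) n := by
  refine le_trans (mul_le_mul_of_nonneg_left ?_ (by positivity)) (mo_lower k n)
  rcases Nat.eq_zero_or_pos k with rfl | hk
  · simp; norm_num
  have hkn : k ≤ n := by nlinarith
  have hn0 : (0 : ℝ) < n := by exact_mod_cast (by omega : 0 < n)
  have h1 := Nat.pow_sub_le_descFactorial n k
  rw [Nat.descFactorial_eq_factorial_mul_choose] at h1
  have h2 : ((n + 1 - k : ℕ) : ℝ) ^ k ≤ k.factorial * (n.choose k : ℝ) := by exact_mod_cast h1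
  refine le_trans ?_ h2
  have h3 : (n : ℝ) * (1 + -((k : ℝ) / n)) ≤ ((n + 1 - k : ℕ) : ℝ) := by
    rw [Nat.cast_sub (by omega)]
    push_cast
    field_simp
    linarith
  have hkn' : (k : ℝ) / n ≤ 1 := by
    rw [div_le_one hn0]; exact_mod_cast hkn
  have h4 := one_add_mul_le_pow (a := -((k : ℝ) / n)) (by linarith) k
  have h5 : (1 : ℝ) / 2 ≤ 1 + k * -((k : ℝ) / n) := by
    have : (k : ℝ) * (k / n) ≤ 1 / 2 := by
      rw [← mul_div_assoc, div_le_div_iff₀ hn0 (by norm_num)]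
      have : ((2 * k ^ 2 : ℕ) : ℝ) ≤ n := by exact_mod_cast hn
      push_cast at this
      nlinarith
    linarith
  calc (n : ℝ) ^ k / 2 = (n : ℝ) ^ k * (1 / 2) := by ring
    _ ≤ (n : ℝ) ^ k * (1 + -((k : ℝ) / n)) ^ k := by gcongr; linarith
    _ = ((n : ℝ) * (1 + -((k : ℝ) / n))) ^ k := by rw [mul_pow]
    _ ≤ _ := pow_le_pow_left₀ (mul_nonneg hn0.le (by linarith)) h3 k

theorem exists_k (ρ : ℝ) (h1 : 1 ≤ ρ) (h2 : ρ < 2) :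
    ∃ k : ℕ, 4 * ρ ^ (2 * k) + 2 < (k.centralBinom : ℝ) / (k + 1) := by
  have hr : |ρ ^ 2 / 4| < 1 := by
    rw [abs_of_nonneg (by positivity)]
    nlinarith
  have ht := tendsto_pow_const_mul_const_pow_of_abs_lt_one 2 hr
  have he := (ht.eventually (gt_mem_nhds (show (0 : ℝ) < 1 / 24 by norm_num))).and
    (eventually_ge_atTop 1)
  obtain ⟨k, hk, hk1⟩ := he.exists
  refine ⟨k, ?_⟩
  have hk1' : (1 : ℝ) ≤ k := by exact_mod_cast hk1
  have h4 : (4 : ℝ) ^ k ≤ 2 * k * k.centralBinom := by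
    exact_mod_cast Nat.four_pow_le_two_mul_self_mul_centralBinom k hk1
  rw [div_pow, ← pow_mul, mul_div_assoc', div_lt_iff₀ (by positivity)] at hk
  have hp : 1 ≤ ρ ^ (2 * k) := one_le_pow₀ h1
  rw [lt_div_iff₀ (by positivity)]
  set z := ρ ^ (2 * k)
  have h5 : 24 * (k : ℝ) ^ 2 * z < 2 * k * k.centralBinom := by linarith
  have h6 : 12 * (k : ℝ) * z < k.centralBinom := by
    have : (2 * (k : ℝ)) * (12 * k * z) < 2 * k * k.centralBinom := by linarith
    exact lt_of_mul_lt_mul_left this (by positivity)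
  have : (4 * z + 2) * ((k : ℝ) + 1) ≤ (6 * z) * (2 * k) := by
    apply mul_le_mul <;> linarith
  linarith

theorem EW_lower (K : ℕ) (ρ ε : ℝ) (h1 : 1 ≤ ρ) (h2 : ρ < 2) (hε : 0 < ε) :
    ∀ᶠ n : ℕ in atTop, (K + 1) * ((ρ - ε) * Real.sqrt n) ≤ EL n (wt (wK K)) := by
  obtain ⟨k, hk⟩ := exists_k ρ h1 h2
  obtain ⟨C, hC, hmo⟩ := mo_upper (2 * k + 1)
  set C' : ℝ := C * 2 ^ (2 * k + 1) with hC'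
  have hC'0 : 0 ≤ C' := by positivity
  set η : ℝ := 1 / (2 * (C' + 1)) with hη
  have hηpos : 0 < η := by positivity
  set D : ℝ := K + 1 + 1 / ε ^ 2 with hD
  have hs : Tendsto (fun n : ℕ => Real.sqrt n) atTop atTop :=
    Real.tendsto_sqrt_atTop.comp tendsto_natCast_atTop_atTop
  filter_upwards [hs.eventually_gt_atTop (4 * D / η), eventually_ge_atTop (2 * k ^ 2),
    eventually_ge_atTop 1] with n hn1 hn2 hn3
  by_contra hcon
  push Not at hcon
  have hnpos : (0 : ℝ) < n := by exact_mod_cast hn3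
  have hn3' : (1 : ℝ) ≤ n := by exact_mod_cast hn3
  set s := Real.sqrt n with hsdef
  have hspos : 0 < s := Real.sqrt_pos.2 hnpos
  have hsq : s ^ 2 = n := Real.sq_sqrt hnpos.le
  have hb := cheb K n (ρ * s) ((ρ - ε) * s) (by nlinarith) hcon.le
  have hb' : EL n (bad K (ρ * s)) ≤ 1 / ε ^ 2 / s := by
    refine hb.trans (le_of_eq ?_)
    rw [← hsdef]
    have : ρ * s - (ρ - ε) * s = ε * s := by ring
    rw [this]
    field_simp
  have hq : q K n ≤ (K + 1) / s := by
    rw [le_div_iff₀ hspos]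
    refine le_trans ?_ (q_le K n)
    refine mul_le_mul_of_nonneg_left ?_ (q_nonneg K n)
    exact Real.sqrt_le_sqrt (by linarith)
  have hqb : q K n + EL n (bad K (ρ * s)) ≤ D / s := by
    rw [hD, add_div]; linarith
  have hup : mo (2 * (2 * k + 1)) n ≤ C' * (s ^ (2 * k + 1)) ^ 2 := by
    refine (hmo n).trans ?_
    rw [hC', mul_assoc, ← pow_mul, mul_comm (2 * k + 1) 2, pow_mul, hsq, ← mul_pow]
    gcongr
    linarith
  have hlo := mo_lower' k n hn2
  have hm := main_ineq K n k (ρ * s) (η / s ^ (2 * k + 1)) (by positivity) (by positivity)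
  set A : ℝ := (k.centralBinom : ℝ) / (k + 1) with hA
  have hnk : (n : ℝ) ^ k = s ^ (2 * k) := by rw [pow_mul, hsq]
  rw [hnk] at hlo
  have hz : 0 < s ^ (2 * k) := by positivity
  have e1 : ρ * s * (A * (s ^ (2 * k) / 2)) ≤ ρ * s * mo (2 * k) n := by gcongr
  have e2 : η / s ^ (2 * k + 1) * mo (2 * (2 * k + 1)) n ≤ η * C' * s ^ (2 * k + 1) := by
    refine (mul_le_mul_of_nonneg_left hup (by positivity)).trans (le_of_eq ?_)
    field_simp
  have e3 : 2 / (η / s ^ (2 * k + 1)) * (q K n + EL n (bad K (ρ * s))) ≤ 2 * D / η * s ^ (2 * k) := by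
    refine (mul_le_mul_of_nonneg_left hqb (by positivity)).trans (le_of_eq ?_)
    field_simp
    ring
  have e4 : η * C' ≤ 1 / 2 := by
    rw [hη, one_div_mul_eq_div, div_le_div_iff₀ (by positivity) (by norm_num)]
    linarith
  have e5 : 2 * D / η < 1 / 2 * s := by
    have : 4 * D / η = 2 * (2 * D / η) := by ring
    linarith
  have e6 : ρ * s * (A * (s ^ (2 * k) / 2)) ≤ 2 * (ρ ^ (2 * k + 1) * s ^ (2 * k + 1)) +
      (1 / 2 * s ^ (2 * k + 1) + 1 / 2 * s * s ^ (2 * k)) := by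
    have e7 : η * C' * s ^ (2 * k + 1) ≤ 1 / 2 * s ^ (2 * k + 1) := by gcongr
    have e8 : 2 * D / η * s ^ (2 * k) ≤ 1 / 2 * s * s ^ (2 * k) := by gcongr
    rw [mul_pow] at hm
    linarith
  have hzz : 0 < s * s ^ (2 * k) := by positivity
  have e9 : (s * s ^ (2 * k)) * (ρ * A / 2) ≤ (s * s ^ (2 * k)) * (2 * ρ ^ (2 * k) * ρ + 1) := by
    refine le_trans (le_of_eq (by ring)) (e6.trans (le_of_eq (by ring)))
  have e10 := le_of_mul_le_mul_left e9 hzz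
  have : ρ * (4 * ρ ^ (2 * k) + 2) < ρ * A := mul_lt_mul_of_pos_left hk (by linarith)
  linarith

end
end PG

namespace PG
section
open scoped Classical

theorem sum_q_le (K m : ℕ) : ∑ i ∈ Finset.range m, q K i ≤ 2 * (K + 1) * Real.sqrt m := by
  induction m with
  | zero => simp
  | succ m ih =>
    rw [Finset.sum_range_succ]
    have h := q_le K m
    push_cast
    have h0 : (0 : ℝ) < (m : ℝ) + 1 := by positivity
    have ha := Real.sq_sqrt h0.le
    have hb := Real.sq_sqrt (Nat.cast_nonneg (α := ℝ) m)
    have hapos := Real.sqrt_pos.2 h0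
    set a := Real.sqrt ((m : ℝ) + 1)
    set b := Real.sqrt (m : ℝ) with hbd
    have hb0 : 0 ≤ b := Real.sqrt_nonneg _
    have hq : q K m ≤ (K + 1) / a := by rwa [le_div_iff₀ hapos]
    have hab : 1 / a ≤ 2 * (a - b) := by
      rw [div_le_iff₀ hapos]
      nlinarith [sq_nonneg (a - b)]
    have : ((K : ℝ) + 1) / a ≤ (K + 1) * (2 * (a - b)) := by
      rw [div_eq_mul_one_div]
      gcongr
    linarith

set_option maxHeartbeats 1000000 in
theorem q_lower (K : ℕ) (η : ℝ) (h0 : 0 < η) (h1 : η < 1) :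
    ∀ᶠ n : ℕ in atTop, ((K : ℝ) + 1) * (1 - 4 * η) ≤ Real.sqrt (n + 1) * q K n := by
  have hE := EW_lower K (2 - η ^ 2 / 2) (η ^ 2 / 2) (by nlinarith) (by nlinarith) (by positivity)
  filter_upwards [hE, tendsto_natCast_atTop_atTop.eventually_ge_atTop (1 / η ^ 2 : ℝ)] with n hn hn2
  set m := ⌊(1 - η) * n⌋₊ with hm
  rw [div_le_iff₀ (by positivity)] at hn2
  have hnpos : (0 : ℝ) < n := by
    by_contra hh
    push Not at hh
    nlinarith [sq_nonneg η]
  have hx0 : 0 ≤ (1 - η) * n := mul_nonneg (by linarith) hnpos.le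
  have hm1 : (m : ℝ) ≤ (1 - η) * n := Nat.floor_le hx0
  have hm2 : (1 - η) * n < m + 1 := Nat.lt_floor_add_one _
  have hmn : m ≤ n := by
    have : (m : ℝ) ≤ n := by nlinarith
    exact_mod_cast this
  rw [EL_wt, ← Finset.sum_range_add_sum_Ico _ hmn] at hn
  have hs1 := sum_q_le K m
  have hm0 : (0 : ℝ) < (m : ℝ) + 1 := by positivity
  have hs2 : ∑ i ∈ Finset.Ico m n, q K i ≤ (n - m) * (((n : ℝ) + 1) * q K n / (m + 1)) := by
    have : ∀ i ∈ Finset.Ico m n, q K i ≤ ((n : ℝ) + 1) * q K n / (m + 1) := by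
      intro i hi
      rw [Finset.mem_Ico] at hi
      have h3 := q_mono K hi.2.le
      simp only at h3
      rw [le_div_iff₀ hm0]
      have : (m : ℝ) ≤ i := by exact_mod_cast hi.1
      have := mul_le_mul_of_nonneg_left this (q_nonneg K i)
      linarith
    refine (Finset.sum_le_sum this).trans (le_of_eq ?_)
    rw [Finset.sum_const, Nat.card_Ico, nsmul_eq_mul, Nat.cast_sub hmn]
  change _ ≤ ∑ i ∈ Finset.range m, q K i + ∑ i ∈ Finset.Ico m n, q K i at hn
  have hsm : Real.sqrt m ≤ (1 - η / 2) * Real.sqrt n := by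
    apply Real.sqrt_le_iff.2
    refine ⟨mul_nonneg (by linarith) (Real.sqrt_nonneg _), ?_⟩
    rw [mul_pow, Real.sq_sqrt hnpos.le]
    nlinarith [sq_nonneg η]
  have hL : (0 : ℝ) < (K : ℝ) + 1 := by positivity
  set L : ℝ := (K : ℝ) + 1 with hLd
  set s := Real.sqrt (n : ℝ) with hs
  have hspos : 0 < s := Real.sqrt_pos.2 hnpos
  have hsq : s ^ 2 = n := Real.sq_sqrt hnpos.le
  have hn1 : (0 : ℝ) < (n : ℝ) + 1 := by positivity
  set s' := Real.sqrt ((n : ℝ) + 1) with hs'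
  have hs'pos : 0 < s' := Real.sqrt_pos.2 hn1
  have hsq' : s' ^ 2 = n + 1 := Real.sq_sqrt hn1.le
  have k1 : L * s * (η * (1 - η)) ≤ (n - m) * (((n : ℝ) + 1) * q K n / (m + 1)) := by
    have := mul_le_mul_of_nonneg_left hsm (show 0 ≤ 2 * L by positivity)
    nlinarith
  rw [← mul_div_assoc, le_div_iff₀ hm0] at k1
  have hQ : 0 ≤ ((n : ℝ) + 1) * q K n := mul_nonneg hn1.le (q_nonneg K n)
  have k2 : L * s * (η * (1 - η)) * ((1 - η) * n) ≤ (η * n * (1 + η)) * (((n : ℝ) + 1) * q K n) := by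
    have a1 : L * s * (η * (1 - η)) * ((1 - η) * n) ≤ L * s * (η * (1 - η)) * (m + 1) := by
      refine mul_le_mul_of_nonneg_left hm2.le ?_
      have : 0 < 1 - η := by linarith
      positivity
    have a2 : ((n : ℝ) - m) ≤ η * n * (1 + η) := by nlinarith
    have a3 := mul_le_mul_of_nonneg_right a2 hQ
    linarith
  have k3 : L * s * (1 - η) ^ 2 ≤ (1 + η) * (((n : ℝ) + 1) * q K n) := by
    have : (η * n) * (L * s * (1 - η) ^ 2) ≤ (η * n) * ((1 + η) * (((n : ℝ) + 1) * q K n)) := by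
      nlinarith
    exact le_of_mul_le_mul_left this (by positivity)
  have k4 : (1 - η) * s' ≤ s := by
    rw [← Real.sqrt_sq (show 0 ≤ (1 - η) * s' from mul_nonneg (by linarith) hs'pos.le)]
    rw [hs]
    apply Real.sqrt_le_sqrt
    rw [mul_pow, hsq']
    have : η * n ≥ 1 := by nlinarith
    nlinarith
  have e : ((n : ℝ) + 1) * q K n = s' * (s' * q K n) := by rw [← hsq']; ring
  rw [e] at k3
  have hx : 0 ≤ s' * q K n := mul_nonneg hs'pos.le (q_nonneg K n)
  have k5 : L * (1 - η) ^ 3 ≤ (1 + η) * (s' * q K n) := by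
    have a1 := mul_le_mul_of_nonneg_left k4 (show 0 ≤ L * (1 - η) ^ 2 by positivity)
    have : s' * (L * (1 - η) ^ 3) ≤ s' * ((1 + η) * (s' * q K n)) := by
      calc s' * (L * (1 - η) ^ 3) = L * (1 - η) ^ 2 * ((1 - η) * s') := by ring
        _ ≤ L * (1 - η) ^ 2 * s := a1
        _ = L * s * (1 - η) ^ 2 := by ring
        _ ≤ _ := k3
        _ = _ := by ring
    exact le_of_mul_le_mul_left this hs'pos
  have k6 : L * ((1 - 4 * η) * (1 + η)) ≤ L * (1 - η) ^ 3 := by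
    refine mul_le_mul_of_nonneg_left ?_ hL.le
    nlinarith [pow_pos h0 3, sq_nonneg η, mul_pos h0 h0]
  have : (1 + η) * (L * (1 - 4 * η)) ≤ (1 + η) * (s' * q K n) := by linarith
  exact le_of_mul_le_mul_left this (by linarith)

theorem q_tendsto (K : ℕ) :
    Tendsto (fun n : ℕ => Real.sqrt (n + 1) * q K n) atTop (nhds ((K : ℝ) + 1)) := by
  have hL : (0 : ℝ) < (K : ℝ) + 1 := by positivity
  refine tendsto_order.2 ⟨fun a ha => ?_, fun a ha => ?_⟩
  · set η : ℝ := min (1 / 2) (((K : ℝ) + 1 - a) / (8 * (K + 1))) with hη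
    have h0 : 0 < η := by
      refine lt_min (by norm_num) (div_pos (by linarith) (by positivity))
    have h1 : η < 1 := lt_of_le_of_lt (min_le_left _ _) (by norm_num)
    have h2 : η ≤ ((K : ℝ) + 1 - a) / (8 * (K + 1)) := min_le_right _ _
    rw [le_div_iff₀ (by positivity)] at h2
    filter_upwards [q_lower K η h0 h1] with n hn
    nlinarith
  · refine Eventually.of_forall fun n => lt_of_le_of_lt ?_ ha
    rw [mul_comm]; exact q_le K n

end
end PG

namespace PG
section
open scoped Classical

noncomputable def ind (p : Prop) : ℝ := if p then 1 else 0

theorem path_lower {Ω : Type*} [MeasurableSpace Ω] {P : Measure Ω}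
    {lam : ℕ → Ω → YoungDiagram} (hP : IsPlancherelGrowthProcess P lam) (n k : ℕ) :
    k ≤ n → ∀ path : ℕ → YoungDiagram, (path k).card = k →
    (∀ i, k ≤ i → i < n → path (i + 1) ∈ up (path i)) →
    d (path k) * d (path n) / n.factorial ≤ P.real {ω | ∀ i, k ≤ i → i ≤ n → lam i ω = path i} := by
  obtain ⟨hprob, hmeas, hpath⟩ := hP
  induction k with
  | zero =>
    intro _ path h0 hs
    have hb : path 0 = ⊥ := by
      have : path 0 ∈ Y 0 := mem_Y.2 h0
      rw [Y_zero] at this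
      simpa using this
    have h := hpath n path hb (fun i hi => mem_up.1 (hs i (Nat.zero_le _) hi))
    have e : {ω | ∀ i, 0 ≤ i → i ≤ n → lam i ω = path i} = {ω | ∀ i ≤ n, lam i ω = path i} := by
      simp
    rw [e, Measure.real, h, hb, ENNReal.toReal_div]
    simp [d, syt_bot]
  | succ k ih =>
    intro hk path hc hs
    set A : YoungDiagram → Set Ω := fun κ =>
      {ω | ∀ i, k ≤ i → i ≤ n → lam i ω = Function.update path k κ i} with hA
    have hAm : ∀ κ, MeasurableSet (A κ) := by
      intro κ
      simp only [hA, Set.ofPred_forall]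
      exact MeasurableSet.iInter fun i => MeasurableSet.iInter fun _ => MeasurableSet.iInter fun _ =>
        hmeas i _
    have hup : ∀ i, k < i → ∀ κ, Function.update path k κ i = path i := fun i hi κ =>
      Function.update_of_ne (by omega) _ _
    have hlow : ∀ κ ∈ dn (path (k + 1)),
        d κ * d (path n) / n.factorial ≤ P.real (A κ) := by
      intro κ hκ
      have h := ih (by omega) (Function.update path k κ) (by
        rw [Function.update_self]
        have := (mem_dn.1 hκ).2
        omega) (by
        intro i h1 h2
        rw [hup (i + 1) (by omega)]
        rcases Nat.eq_or_lt_of_le h1 with rfl | h3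
        · rw [Function.update_self]; exact mem_dn_iff.1 hκ
        · rw [hup i h3]; exact hs i h3 h2)
      rw [Function.update_self, hup n (by omega)] at h
      exact h
    have hdis : ((dn (path (k + 1)) : Finset YoungDiagram) : Set YoungDiagram).PairwiseDisjoint A := by
      intro a _ b _ hab
      refine Set.disjoint_left.2 fun ω ha hb => hab ?_
      have h1 := ha k le_rfl (by omega)
      have h2 := hb k le_rfl (by omega)
      rw [Function.update_self] at h1 h2
      rw [← h1, ← h2]
    have hsub : (⋃ κ ∈ dn (path (k + 1)), A κ) ⊆
        {ω | ∀ i, k + 1 ≤ i → i ≤ n → lam i ω = path i} := by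
      intro ω hω
      simp only [Set.mem_iUnion] at hω
      obtain ⟨κ, _, h⟩ := hω
      intro i h1 h2
      rw [h i (by omega) h2, hup i (by omega)]
    refine le_trans ?_ (measureReal_mono hsub)
    rw [measureReal_biUnion_finset hdis (fun κ _ => hAm κ)]
    refine le_trans (le_of_eq ?_) (Finset.sum_le_sum hlow)
    rw [← Finset.sum_div, ← Finset.sum_mul, d_dn _ (by omega)]

theorem pair_lower {Ω : Type*} [MeasurableSpace Ω] {P : Measure Ω}
    {lam : ℕ → Ω → YoungDiagram} (hP : IsPlancherelGrowthProcess P lam) (n : ℕ)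
    {ν μ : YoungDiagram} (hν : ν ∈ Y n) (hμ : μ ∈ up ν) :
    d ν * d μ / (n + 1).factorial ≤ P.real {ω | lam n ω = ν ∧ lam (n + 1) ω = μ} := by
  have := hP.1
  have h := path_lower hP (n + 1) n (Nat.le_succ n) (fun i => if i ≤ n then ν else μ)
    (by simpa using mem_Y.1 hν) (by
      intro i h1 h2
      have : i = n := by omega
      subst this
      simpa using hμ)
  simp only [le_refl, if_true, show ¬ (n + 1 ≤ n) by omega, if_false] at h
  refine h.trans (measureReal_mono ?_)
  intro ω hω
  have h1 := hω n le_rfl (by omega)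
  have h2 := hω (n + 1) (by omega) le_rfl
  simp at h1 h2
  exact ⟨h1, h2⟩

theorem union_lower {Ω : Type*} [MeasurableSpace Ω] {P : Measure Ω}
    {lam : ℕ → Ω → YoungDiagram} (hP : IsPlancherelGrowthProcess P lam) (n : ℕ)
    (Q : YoungDiagram → YoungDiagram → Prop) :
    ∃ B : Set Ω, MeasurableSet B ∧ B ⊆ {ω | Q (lam n ω) (lam (n + 1) ω)} ∧
      ES n (fun ν μ => ind (Q ν μ)) ≤ P.real B := by
  have := hP.1
  set S : Finset ((_ : YoungDiagram) × YoungDiagram) :=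
    ((Y n).sigma up).filter (fun p => Q p.1 p.2) with hS
  set A : ((_ : YoungDiagram) × YoungDiagram) → Set Ω :=
    fun p => {ω | lam n ω = p.1 ∧ lam (n + 1) ω = p.2} with hA
  have hAm : ∀ p, MeasurableSet (A p) := fun p => (hP.2.1 n p.1).inter (hP.2.1 (n + 1) p.2)
  have hdis : (S : Set ((_ : YoungDiagram) × YoungDiagram)).PairwiseDisjoint A := by
    rintro ⟨a, a'⟩ _ ⟨b, b'⟩ _ hab
    refine Set.disjoint_left.2 fun ω ha hb => hab ?_
    obtain ⟨h1, h2⟩ := ha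
    obtain ⟨h3, h4⟩ := hb
    simp only at h1 h2 h3 h4
    rw [← h1, ← h2, ← h3, ← h4]
  refine ⟨⋃ p ∈ S, A p, S.measurableSet_biUnion fun p _ => hAm p, ?_, ?_⟩
  · intro ω hω
    simp only [Set.mem_iUnion] at hω
    obtain ⟨p, hp, h1, h2⟩ := hω
    rw [hS, Finset.mem_filter] at hp
    show Q _ _
    rw [h1, h2]; exact hp.2
  · rw [measureReal_biUnion_finset hdis (fun p _ => hAm p), hS, Finset.sum_filter, Finset.sum_sigma,
      ES, Finset.sum_div]
    refine Finset.sum_le_sum fun ν hν => ?_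
    rw [Finset.sum_div]
    refine Finset.sum_le_sum fun μ hμ => ?_
    by_cases hQ : Q ν μ
    · simp only [ind, hQ, if_true, one_mul]
      exact pair_lower hP n hν hμ
    · simp [ind, hQ]

theorem prob_eq {Ω : Type*} [MeasurableSpace Ω] {P : Measure Ω}
    {lam : ℕ → Ω → YoungDiagram} (hP : IsPlancherelGrowthProcess P lam) (n : ℕ)
    (Q : YoungDiagram → YoungDiagram → Prop) :
    P.real {ω | Q (lam n ω) (lam (n + 1) ω)} = ES n (fun ν μ => ind (Q ν μ)) := by
  have := hP.1
  apply le_antisymm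
  · obtain ⟨B, hB, hs, hl⟩ := union_lower hP n (fun ν μ => ¬ Q ν μ)
    have h1 : {ω | Q (lam n ω) (lam (n + 1) ω)} ⊆ Bᶜ := fun ω hω hb => hs hb hω
    have h2 := measureReal_mono (μ := P) h1
    rw [probReal_compl_eq_one_sub hB] at h2
    have h3 : ES n (fun ν μ => ind (Q ν μ)) +
        ES n (fun ν μ => ind (¬ Q ν μ)) = 1 := by
      rw [← ES_add]
      refine Eq.trans ?_ (ES_const n 1)
      apply ES_congr
      intro ν μ _ _
      by_cases h : Q ν μ <;> simp [ind, h]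
    linarith
  · obtain ⟨B, hB, hs, hl⟩ := union_lower hP n Q
    exact hl.trans (measureReal_mono hs)

theorem rowLen_up {ν μ : YoungDiagram} {i : ℕ}
    (h2 : μ.cells = insert (i, ν.rowLen i) ν.cells) (r : ℕ) :
    μ.rowLen r = ν.rowLen r + 1 ↔ r = i := by
  have hm : ∀ a b, (a, b) ∈ μ ↔ ((a = i ∧ b = ν.rowLen i) ∨ (a, b) ∈ ν) := by
    intro a b
    rw [← YoungDiagram.mem_cells, h2, Finset.mem_insert, YoungDiagram.mem_cells, Prod.mk.injEq]
  have hm' : ∀ a b, b < μ.rowLen a ↔ ((a = i ∧ b = ν.rowLen i) ∨ b < ν.rowLen a) := by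
    intro a b
    rw [← YoungDiagram.mem_iff_lt_rowLen, ← YoungDiagram.mem_iff_lt_rowLen, hm]
  constructor
  · intro h
    have := (hm' r (ν.rowLen r)).1 (by omega)
    rcases this with h | h
    · exact h.1
    · omega
  · rintro rfl
    have a1 := (hm' r (ν.rowLen r)).2 (Or.inl ⟨rfl, rfl⟩)
    have a2 := hm' r (ν.rowLen r + 1)
    by_contra hne
    have := a2.1 (by omega)
    omega

/-- no box added in rows `≤ K` -/
def NoLow (K : ℕ) (ν μ : YoungDiagram) : Prop :=
  ∀ r < K + 1, μ.rowLen r ≠ ν.rowLen r + 1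

theorem ind_NoLow (K : ℕ) {ν μ : YoungDiagram} (h : μ ∈ up ν) :
    ind (NoLow K ν μ) = 1 - R K ν μ := by
  obtain ⟨i, h1, h2, _⟩ := up_cell h
  rw [R, wt_up h1 h2, wK]
  have : NoLow K ν μ ↔ ¬ i ≤ K := by
    simp only [NoLow, ne_eq, rowLen_up h2]
    constructor
    · intro hh hi
      exact hh i (by omega) rfl
    · rintro hh r hr rfl
      omega
  by_cases hi : i ≤ K <;> simp [ind, this, hi]

theorem compl_eq {Ω : Type*} (lam : ℕ → Ω → YoungDiagram) (K n : ℕ) :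
    (⋃ r ∈ Finset.range (K + 1), growthEvent lam n r)ᶜ =
      {ω | NoLow K (lam n ω) (lam (n + 1) ω)} := by
  ext ω
  simp [NoLow, growthEvent]

theorem prob_NoLow {Ω : Type*} [MeasurableSpace Ω] {P : Measure Ω}
    {lam : ℕ → Ω → YoungDiagram} (hP : IsPlancherelGrowthProcess P lam) (K n : ℕ) :
    P.real ((⋃ r ∈ Finset.range (K + 1), growthEvent lam n r)ᶜ) = 1 - q K n := by
  rw [compl_eq, prob_eq hP n (NoLow K), q_eq]
  conv_rhs => rw [← ES_const n 1]
  rw [← ES_sub]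
  exact ES_congr fun ν μ _ h => ind_NoLow K h

theorem prob_NoLow_inter {Ω : Type*} [MeasurableSpace Ω] {P : Measure Ω}
    {lam : ℕ → Ω → YoungDiagram} (hP : IsPlancherelGrowthProcess P lam) (K n : ℕ)
    (μ : YoungDiagram) :
    P.real ({ω | lam (n + 1) ω = μ} ∩ (⋃ r ∈ Finset.range (K + 1), growthEvent lam n r)ᶜ) =
      if μ.card = n + 1 then (d μ ^ 2 - U K μ * d μ) / (n + 1).factorial else 0 := by
  have e : {ω | lam (n + 1) ω = μ} ∩ (⋃ r ∈ Finset.range (K + 1), growthEvent lam n r)ᶜ =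
      {ω | (fun ν μ' => μ' = μ ∧ NoLow K ν μ') (lam n ω) (lam (n + 1) ω)} := by
    rw [compl_eq]; rfl
  rw [e, prob_eq hP n (fun ν μ' => μ' = μ ∧ NoLow K ν μ')]
  have e2 : ES n (fun ν μ' => ind (μ' = μ ∧ NoLow K ν μ')) =
      ES n (fun ν μ' => if μ' = μ then 1 - R K ν μ' else 0) := by
    apply ES_congr
    intro ν μ' _ h
    rw [← ind_NoLow K h]
    by_cases h1 : μ' = μ <;> by_cases h2 : NoLow K ν μ' <;> simp [ind, h1, h2]
  rw [e2, ES, sum_swap n (fun ν μ' => (if μ' = μ then 1 - R K ν μ' else 0) * (d ν * d μ'))]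
  have e3 : ∀ μ' ∈ Y (n + 1), ∑ ν ∈ dn μ', (if μ' = μ then 1 - R K ν μ' else 0) * (d ν * d μ') =
      if μ' = μ then d μ ^ 2 - U K μ * d μ else 0 := by
    intro μ' hμ'
    by_cases h : μ' = μ
    · subst h
      simp only [if_true]
      have hd := d_dn μ' (by rw [mem_Y.1 hμ']; omega)
      have : ∀ ν ∈ dn μ', (1 - R K ν μ') * (d ν * d μ') = d ν * d μ' - R K ν μ' * d ν * d μ' := by
        intro ν _; ring
      rw [Finset.sum_congr rfl this, Finset.sum_sub_distrib, ← Finset.sum_mul, ← Finset.sum_mul, hd, U]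
      ring
    · simp [h]
  rw [Finset.sum_congr rfl e3, Finset.sum_ite_eq']
  simp only [mem_Y]
  split_ifs <;> simp

theorem tv_le {Ω : Type*} [MeasurableSpace Ω] {P : Measure Ω}
    {lam : ℕ → Ω → YoungDiagram} (hP : IsPlancherelGrowthProcess P lam) (K n : ℕ)
    (hq : q K n ≤ 1 / 2) :
    Real.sqrt (n + 1) *
        ((1 / 2) * ∑' μ : YoungDiagram,
          |plancherelProb (n + 1) μ -
            (P ({ω | lam (n + 1) ω = μ} ∩ (⋃ r ∈ Finset.range (K + 1), growthEvent lam n r)ᶜ)).toReal /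
              (P ((⋃ r ∈ Finset.range (K + 1), growthEvent lam n r)ᶜ)).toReal|) ≤
      Real.sqrt (2 * (K + 1) * (K + 1 - Real.sqrt (n + 1) * q K n)) +
        |K + 1 - Real.sqrt (n + 1) * q K n| := by
  have h1 := prob_NoLow hP K n
  have h2 := prob_NoLow_inter hP K n
  simp only [Measure.real] at h1 h2
  rw [h1]
  simp only [h2]
  rw [tsum_eq_sum (s := Y (n + 1)) (by
    intro μ hμ
    rw [mem_Y] at hμ
    simp [plancherelProb, hμ])]
  have hn : (0 : ℝ) < (n : ℝ) + 1 := by positivity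
  have hL2 := L2_bound K n
  set r := Real.sqrt ((n : ℝ) + 1) with hr
  have hrpos : 0 < r := Real.sqrt_pos.2 hn
  have hrsq : r ^ 2 = n + 1 := Real.sq_sqrt hn.le
  set T := ∑ μ ∈ Y (n + 1), |U K μ * d μ / (n + 1).factorial -
      (K + 1) / r * (d μ ^ 2 / (n + 1).factorial)| with hT
  have hT0 : 0 ≤ T := Finset.sum_nonneg fun _ _ => abs_nonneg _
  have h3 : ∑ μ ∈ Y (n + 1), |plancherelProb (n + 1) μ -
      (if μ.card = n + 1 then (d μ ^ 2 - U K μ * d μ) / (n + 1).factorial else 0) / (1 - q K n)| ≤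
      2 * (T + |(K + 1) / r - q K n|) := by
    have : ∀ μ ∈ Y (n + 1), |plancherelProb (n + 1) μ -
      (if μ.card = n + 1 then (d μ ^ 2 - U K μ * d μ) / (n + 1).factorial else 0) / (1 - q K n)| ≤
      2 * (|U K μ * d μ / (n + 1).factorial - (K + 1) / r * (d μ ^ 2 / (n + 1).factorial)| +
        |(K + 1) / r - q K n| * (d μ ^ 2 / (n + 1).factorial)) := by
      intro μ hμ
      rw [mem_Y] at hμ
      simp only [plancherelProb, hμ, if_true]
      change |d μ ^ 2 / _ - _| ≤ _
      set p := d μ ^ 2 / ((n + 1).factorial : ℝ) with hp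
      have hp0 : 0 ≤ p := by positivity
      rw [sub_div, ← hp]
      set j := U K μ * d μ / ((n + 1).factorial : ℝ) with hj
      have hq1 : 0 < 1 - q K n := by linarith
      have e : p - (p - j) / (1 - q K n) = (j - q K n * p) / (1 - q K n) := by
        field_simp
        ring
      rw [e, abs_div, abs_of_pos hq1, div_le_iff₀ hq1]
      have e2 : j - q K n * p = (j - (K + 1) / r * p) + ((K + 1) / r - q K n) * p := by ring
      have e3 : |j - q K n * p| ≤ |j - (K + 1) / r * p| + |(K + 1) / r - q K n| * p := by
        rw [e2]
        refine (abs_add_le _ _).trans ?_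
        rw [abs_mul _ p, abs_of_nonneg hp0]
      have e4 : 0 ≤ |j - (K + 1) / r * p| + |(K + 1) / r - q K n| * p := by positivity
      nlinarith
    refine (Finset.sum_le_sum this).trans (le_of_eq ?_)
    rw [← Finset.mul_sum, Finset.sum_add_distrib, ← Finset.mul_sum, ← Finset.sum_div, sum_d_sq]
    rw [div_self (by positivity), mul_one]
  have h4 : r * T ≤ Real.sqrt (2 * (K + 1) * (K + 1 - r * q K n)) := by
    apply Real.le_sqrt_of_sq_le
    rw [mul_pow, hrsq]
    linarith
  have h5 : r * |(K + 1) / r - q K n| = |K + 1 - r * q K n| := by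
    rw [← abs_of_pos hrpos, ← abs_mul, abs_of_pos hrpos]
    congr 1
    field_simp
  calc _ ≤ r * (1 / 2 * (2 * (T + |(K + 1) / r - q K n|))) := by gcongr
    _ = r * T + r * |(K + 1) / r - q K n| := by ring
    _ ≤ _ := by rw [h5]; linarith

theorem q_small (K : ℕ) : ∀ᶠ n : ℕ in atTop, q K n ≤ 1 / 2 := by
  have hs : Tendsto (fun n : ℕ => Real.sqrt n) atTop atTop :=
    Real.tendsto_sqrt_atTop.comp tendsto_natCast_atTop_atTop
  filter_upwards [hs.eventually_ge_atTop (2 * ((K : ℝ) + 1))] with n hn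
  have h := q_le K n
  have h2 : Real.sqrt n ≤ Real.sqrt (n + 1) := Real.sqrt_le_sqrt (by linarith)
  have hK : (0 : ℝ) < (K : ℝ) + 1 := by positivity
  by_contra hh
  push Not at hh
  nlinarith

theorem final {Ω : Type*} [MeasurableSpace Ω]
    (P : Measure Ω) (lam : ℕ → Ω → YoungDiagram)
    (hPGP : IsPlancherelGrowthProcess P lam) (K : ℕ) :
    Filter.Tendsto
      (fun n : ℕ => Real.sqrt (n + 1) *
        ((1 / 2) * ∑' μ : YoungDiagram,
          |plancherelProb (n + 1) μ -
            (P ({ω | lam (n + 1) ω = μ} ∩ (⋃ r ∈ Finset.range (K + 1), growthEvent lam n r)ᶜ)).toReal /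
              (P ((⋃ r ∈ Finset.range (K + 1), growthEvent lam n r)ᶜ)).toReal|))
      Filter.atTop (nhds 0) := by
  have hlim : Tendsto (fun n : ℕ => Real.sqrt (2 * (K + 1) * (K + 1 - Real.sqrt (n + 1) * q K n)) +
        |(K : ℝ) + 1 - Real.sqrt (n + 1) * q K n|) atTop (nhds 0) := by
    have h1 : Tendsto (fun n : ℕ => (K : ℝ) + 1 - Real.sqrt (n + 1) * q K n) atTop (nhds 0) := by
      have := (tendsto_const_nhds (x := (K : ℝ) + 1)).sub (q_tendsto K)
      rwa [sub_self] at this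
    have h2 := (h1.const_mul (2 * ((K : ℝ) + 1))).sqrt
    have h3 := h2.add h1.abs
    simpa using h3
  refine tendsto_of_tendsto_of_tendsto_of_le_of_le' tendsto_const_nhds hlim ?_ ?_
  · refine Eventually.of_forall fun n => ?_
    refine mul_nonneg (Real.sqrt_nonneg _) (mul_nonneg (by norm_num) (tsum_nonneg fun _ => abs_nonneg _))
  · filter_upwards [q_small K] with n hn
    exact tv_le hPGP K n hn

end
end PG

/-- Fix `K ≥ 0`.  The total variation distance between the Plancherel measure `Pl_n` (the
distribution of `λ⁽ⁿ⁾`) and the conditional distribution of `λ⁽ⁿ⁾` given that none of the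
events `E_0⁽ⁿ⁾, …, E_K⁽ⁿ⁾` occurred is `o(1/√n)` as `n → ∞`; equivalently `√n` times this
distance tends to `0`.  (With our indexing, step `n+1`: the conditioning event is the
complement of `⋃_{r ≤ K} growthEvent lam n r` and the diagram is `lam (n+1)`.) -/
theorem tv_conditional_given_no_low_row_growth {Ω : Type*} [MeasurableSpace Ω]
    (P : Measure Ω) (lam : ℕ → Ω → YoungDiagram)
    (hPGP : IsPlancherelGrowthProcess P lam) (K : ℕ) :
    Filter.Tendsto
      (fun n : ℕ => Real.sqrt (n + 1) *
        ((1 / 2) * ∑' μ : YoungDiagram,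
          |plancherelProb (n + 1) μ -
            (P ({ω | lam (n + 1) ω = μ} ∩ (⋃ r ∈ Finset.range (K + 1), growthEvent lam n r)ᶜ)).toReal /
              (P ((⋃ r ∈ Finset.range (K + 1), growthEvent lam n r)ᶜ)).toReal|))
      Filter.atTop (nhds 0) := by
  exact PG.final P lam hPGP K
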